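/- A map of simplicial sets is anodyne if and only if it is both a monomorphism and a weak homotopy equivalence. -/

import Mathlib

open CategoryTheory CategoryTheory.Limits Simplicial MonoidalCategory SSet

noncomputable instance : MonoidalClosed SSet.{0} :=
  (inferInstance : MonoidalClosed (SimplexCategoryᵒᵖ ⥤ Type 0))

namespace Paper

/-- A map of simplicial sets is a *trivial fibration* if it has the right lifting
property with respect to all boundary inclusions `∂Δ[n] ⟶ Δ[n]` for `n ≥ 0`. -/
def TrivialFibration {X Y : SSet.{0}} (p : X ⟶ Y) : Prop :=
  ∀ n : ℕ, HasLiftingProperty (SSet.boundary n).ι p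

/-- A map of simplicial sets is a *Kan fibration* if it has the right lifting property
with respect to all horn inclusions `Λ[n, i] ⟶ Δ[n]` for `n ≥ 1`, `0 ≤ i ≤ n`. -/
def KanFibration {X Y : SSet.{0}} (p : X ⟶ Y) : Prop :=
  ∀ (n : ℕ) (i : Fin (n + 2)), HasLiftingProperty (SSet.horn (n + 1) i).ι p

/-- An *anodyne* map is one with the left lifting property with respect to
all Kan fibrations. -/
def Anodyne {A B : SSet.{0}} (i : A ⟶ B) : Prop :=
  ∀ ⦃X Y : SSet.{0}⦄ (p : X ⟶ Y), KanFibration p → HasLiftingProperty i p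

/-- The unique map to `Δ[0]`. -/
def toPt (X : SSet.{0}) : X ⟶ Δ[0] where
  app m := TypeCat.ofHom fun _ => SSet.stdSimplex.const 0 0 m
  naturality := by
    intro m m' φ
    ext x
    apply stdSimplex.objEquiv.injective
    apply SimplexCategory.Hom.ext
    apply OrderHom.ext
    funext j
    exact @Subsingleton.elim (Fin 1) _ _ _

/-- A *Kan complex* is a simplicial set whose map to `Δ[0]` is a Kan fibration. -/
def KanComplex (X : SSet.{0}) : Prop :=
  KanFibration (toPt X)

/-- The constant map at the vertex `k` of `Δ[1]`. -/
def cst (X : SSet.{0}) (k : Fin 2) : X ⟶ Δ[1] where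
  app m := TypeCat.ofHom fun _ => SSet.stdSimplex.const 1 k m
  naturality := by
    intro m m' φ
    ext x
    apply stdSimplex.objEquiv.injective
    apply SimplexCategory.Hom.ext
    ext j
    rfl

/-- The endpoint inclusion `X ⟶ X ⊗ Δ[1]` at the vertex `k` of `Δ[1]`. -/
noncomputable def ept (X : SSet.{0}) (k : Fin 2) : X ⟶ X ⊗ Δ[1] :=
  CartesianMonoidalCategory.lift (𝟙 X) (cst X k)

/-- A (single-step) homotopy from `f` to `g`, as a property of the pair `(f, g)`. -/
def Homotopy {X Y : SSet.{0}} (f g : X ⟶ Y) : Prop :=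
  ∃ H : X ⊗ Δ[1] ⟶ Y, ept X 0 ≫ H = f ∧ ept X 1 ≫ H = g

/-- `f` and `g` are *homotopic* if they are connected by a zig-zag of homotopies. -/
def Homotopic {X Y : SSet.{0}} (f g : X ⟶ Y) : Prop :=
  Relation.EqvGen Homotopy f g

/-- A *homotopy equivalence* of simplicial sets. -/
def HomotopyEquivalence {X Y : SSet.{0}} (f : X ⟶ Y) : Prop :=
  ∃ g : Y ⟶ X, Homotopic (f ≫ g) (𝟙 X) ∧ Homotopic (g ≫ f) (𝟙 Y)

/-- A map `f : X ⟶ Y` is a *weak homotopy equivalence* if for every Kan complex `K`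
the induced map `K^Y ⟶ K^X` on exponentials is a homotopy equivalence. -/
def WeakHomotopyEquivalence {X Y : SSet.{0}} (f : X ⟶ Y) : Prop :=
  ∀ K : SSet.{0}, KanComplex K → HomotopyEquivalence ((MonoidalClosed.pre f).app K)

/-- A homotopy `H` between maps over `B` which is *fiberwise over `B`*. -/
def FibHomotopy {B X Y : SSet.{0}} (pX : X ⟶ B) (pY : Y ⟶ B) (f g : X ⟶ Y) : Prop :=
  ∃ H : X ⊗ Δ[1] ⟶ Y, ept X 0 ≫ H = f ∧ ept X 1 ≫ H = g ∧
    H ≫ pY = CartesianMonoidalCategory.fst X Δ[1] ≫ pX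

/-- Connectedness by a zig-zag of fiberwise homotopies over `B`. -/
def FibHomotopic {B X Y : SSet.{0}} (pX : X ⟶ B) (pY : Y ⟶ B) (f g : X ⟶ Y) : Prop :=
  Relation.EqvGen (FibHomotopy pX pY) f g

/-- A *fiberwise homotopy equivalence over `B`*. -/
def FibHomotopyEquivalence {B X Y : SSet.{0}} (pX : X ⟶ B) (pY : Y ⟶ B) (f : X ⟶ Y) : Prop :=
  f ≫ pY = pX ∧ ∃ g : Y ⟶ X, g ≫ pX = pY ∧
    FibHomotopic pX pX (f ≫ g) (𝟙 X) ∧ FibHomotopic pY pY (g ≫ f) (𝟙 Y)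

end Paper

namespace Paper

/-! ### Elementwise tools -/

section Elementwise

variable {X Y : SSet.{0}}

lemma app_map (f : X ⟶ Y) {n m : SimplexCategoryᵒᵖ} (g : n ⟶ m) (x : X.obj n) :
    f.app m (X.map g x) = Y.map g (f.app n x) :=
  ConcreteCategory.congr_hom (f.naturality g) x

lemma hom_ext_app {f g : X ⟶ Y} (h : ∀ n (x : X.obj n), f.app n x = g.app n x) : f = g := by
  ext n x
  exact h n x

lemma app_eq {f g : X ⟶ Y} (h : f = g) {n : SimplexCategoryᵒᵖ} (x : X.obj n) :
    f.app n x = g.app n x := by rw [h]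

/-- A map of simplicial sets from a natural family of functions. -/
def mkHom (φ : ∀ n, X.obj n → Y.obj n)
    (h : ∀ {n m : SimplexCategoryᵒᵖ} (g : n ⟶ m) (x : X.obj n),
      φ m (X.map g x) = Y.map g (φ n x)) : X ⟶ Y where
  app n := TypeCat.ofHom (φ n)
  naturality n m g := by
    ext x
    exact h g x

@[simp]
lemma mkHom_app (φ : ∀ n, X.obj n → Y.obj n)
    (h : ∀ {n m : SimplexCategoryᵒᵖ} (g : n ⟶ m) (x : X.obj n),
      φ m (X.map g x) = Y.map g (φ n x)) (n : SimplexCategoryᵒᵖ) (x : X.obj n) :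
    (mkHom φ h).app n x = φ n x := rfl

lemma mono_iff_app_injective (f : X ⟶ Y) :
    Mono f ↔ ∀ n, Function.Injective (f.app n) := by
  rw [NatTrans.mono_iff_mono_app]
  simp only [CategoryTheory.mono_iff_injective]

lemma app_injective (f : X ⟶ Y) [hf : Mono f] (n : SimplexCategoryᵒᵖ) :
    Function.Injective (f.app n) :=
  (mono_iff_app_injective f).1 hf n

lemma map_id_app (n : SimplexCategoryᵒᵖ) (x : X.obj n) : X.map (𝟙 n) x = x := by simp

lemma map_comp_app {n m k : SimplexCategoryᵒᵖ} (f : n ⟶ m) (g : m ⟶ k) (x : X.obj n) :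
    X.map (f ≫ g) x = X.map g (X.map f x) := by simp

@[simp]
lemma ept_app (k : Fin 2) (n : SimplexCategoryᵒᵖ) (x : X.obj n) :
    (ept X k).app n x = (x, stdSimplex.const 1 k n) := rfl

lemma ept_whiskerRight (f : X ⟶ Y) (k : Fin 2) : ept X k ≫ f ▷ Δ[1] = f ≫ ept Y k := rfl

@[simp]
lemma map_const (k : Fin 2) {n m : SimplexCategoryᵒᵖ} (g : n ⟶ m) :
    (Δ[1] : SSet.{0}).map g (stdSimplex.const 1 k n) = stdSimplex.const 1 k m := rfl

instance (k : Fin 2) : Mono (ept X k) :=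
  (mono_iff_app_injective _).2 fun _ _ _ h => congr_arg Prod.fst h

instance (f : X ⟶ Y) [Mono f] (Z : SSet.{0}) : Mono (f ▷ Z) :=
  (mono_iff_app_injective _).2 fun n ⟨_, _⟩ ⟨_, _⟩ h =>
    Prod.ext (app_injective f n (congr_arg Prod.fst h)) (Prod.mk.inj h).2

instance (f : X ⟶ Y) [Mono f] (Z : SSet.{0}) : Mono (Z ◁ f) :=
  (mono_iff_app_injective _).2 fun n ⟨_, _⟩ ⟨_, _⟩ h =>
    Prod.ext (Prod.mk.inj h).1 (app_injective f n (congr_arg Prod.snd h))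

end Elementwise

/-! ### Kan fibrations and anodyne maps in terms of lifting properties -/

lemma kanFibration_iff {X Y : SSet.{0}} (p : X ⟶ Y) :
    KanFibration p ↔ modelCategoryQuillen.J.rlp p := by
  constructor
  · intro h A B i hi
    simp only [modelCategoryQuillen.J, MorphismProperty.iSup_iff] at hi
    obtain ⟨n, ⟨k⟩⟩ := hi
    exact h n k
  · intro h n k
    exact h _ (modelCategoryQuillen.horn_ι_mem_J (n + 1) k)

lemma anodyne_iff_anodyneExtensions {A B : SSet.{0}} (i : A ⟶ B) :
    Anodyne i ↔ anodyneExtensions i := by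
  rw [anodyneExtensions_eq_llp_rlp]
  exact ⟨fun h X Y p hp => h p ((kanFibration_iff p).2 hp),
    fun h X Y p hp => h p ((kanFibration_iff p).1 hp)⟩

lemma KanFibration.comp {X Y Z : SSet.{0}} {p : X ⟶ Y} {q : Y ⟶ Z} (hp : KanFibration p)
    (hq : KanFibration q) : KanFibration (p ≫ q) := fun n k => by
  have := hp n k
  have := hq n k
  infer_instance

lemma KanFibration.of_isPullback {X Y X' Y' : SSet.{0}} {f : X' ⟶ X} {p' : X' ⟶ Y'}
    {p : X ⟶ Y} {g : Y' ⟶ Y} (h : IsPullback f p' p g) (hp : KanFibration p) :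
    KanFibration p' := fun n k => by
  have := hp n k
  exact h.hasLiftingProperty _

/-! ### Lifting and gluing -/

section Gluing

variable {N X Y : SSet.{0}} {S : N.Subcomplex} {p : X ⟶ Y}

lemma exists_lift_of_rel (hS : HasLiftingProperty S.ι p) (b : N ⟶ Y)
    (R : ∀ n, N.obj n → X.obj n → Prop)
    (hnat : ∀ {n m : SimplexCategoryᵒᵖ} (g : n ⟶ m) (x : N.obj n) (y : X.obj n),
      R n x y → R m (N.map g x) (X.map g y))
    (huniq : ∀ n (x : N.obj n) (y y' : X.obj n), R n x y → R n x y' → y = y')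
    (hex : ∀ n (x : N.obj n), x ∈ S.obj n ↔ ∃ y, R n x y)
    (hb : ∀ n (x : N.obj n) (y : X.obj n), R n x y → p.app n y = b.app n x) :
    ∃ L : N ⟶ X, L ≫ p = b ∧ ∀ n (x : N.obj n) (y : X.obj n), R n x y → L.app n x = y := by
  choose φ hφ using fun n (x : (S : SSet).obj n) => (hex n x.1).1 x.2
  let f : (S : SSet) ⟶ X := mkHom φ fun g x =>
    huniq _ _ _ _ (hφ _ ((S : SSet).map g x)) (hnat g _ _ (hφ _ x))
  have sq : CommSq f S.ι p b := ⟨hom_ext_app fun n x => hb n _ _ (hφ n x)⟩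
  refine ⟨sq.lift, sq.fac_right, fun n x y h => ?_⟩
  have hx := (hex n x).2 ⟨y, h⟩
  exact (app_eq sq.fac_left ⟨x, hx⟩).trans (huniq n x _ _ (hφ n ⟨x, hx⟩) h)

lemma exists_lift_two (hS : HasLiftingProperty S.ι p) (b : N ⟶ Y) {T₁ T₂ : SSet.{0}}
    (t₁ : T₁ ⟶ N) (t₂ : T₂ ⟶ N) [Mono t₁] [Mono t₂] (f₁ : T₁ ⟶ X) (f₂ : T₂ ⟶ X)
    (hcov : ∀ n (x : N.obj n), x ∈ S.obj n ↔ (∃ a, t₁.app n a = x) ∨ ∃ a, t₂.app n a = x)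
    (h₁₂ : ∀ n a₁ a₂, t₁.app n a₁ = t₂.app n a₂ → f₁.app n a₁ = f₂.app n a₂)
    (hb₁ : f₁ ≫ p = t₁ ≫ b) (hb₂ : f₂ ≫ p = t₂ ≫ b) :
    ∃ L : N ⟶ X, L ≫ p = b ∧ t₁ ≫ L = f₁ ∧ t₂ ≫ L = f₂ := by
  obtain ⟨L, hL, hR⟩ := exists_lift_of_rel hS b
    (fun n x y => (∃ a, t₁.app n a = x ∧ f₁.app n a = y) ∨ ∃ a, t₂.app n a = x ∧ f₂.app n a = y)
    (by
      rintro n m g _ _ (⟨a, rfl, rfl⟩ | ⟨a, rfl, rfl⟩)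
      · exact .inl ⟨T₁.map g a, app_map .., app_map ..⟩
      · exact .inr ⟨T₂.map g a, app_map .., app_map ..⟩)
    (by
      rintro n _ _ _ (⟨a, rfl, rfl⟩ | ⟨a, rfl, rfl⟩) (⟨a', h, rfl⟩ | ⟨a', h, rfl⟩)
      · rw [app_injective t₁ n h]
      · exact h₁₂ n _ _ h.symm
      · exact (h₁₂ n _ _ h).symm
      · rw [app_injective t₂ n h])
    (by
      intro n x
      rw [hcov]
      constructor
      · rintro (⟨a, rfl⟩ | ⟨a, rfl⟩)
        · exact ⟨_, .inl ⟨a, rfl, rfl⟩⟩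
        · exact ⟨_, .inr ⟨a, rfl, rfl⟩⟩
      · rintro ⟨_, ⟨a, h, -⟩ | ⟨a, h, -⟩⟩
        · exact .inl ⟨a, h⟩
        · exact .inr ⟨a, h⟩)
    (by
      rintro n _ _ (⟨a, rfl, rfl⟩ | ⟨a, rfl, rfl⟩)
      · exact app_eq hb₁ a
      · exact app_eq hb₂ a)
  exact ⟨L, hL, hom_ext_app fun n a => hR n _ _ (.inl ⟨a, rfl, rfl⟩),
    hom_ext_app fun n a => hR n _ _ (.inr ⟨a, rfl, rfl⟩)⟩

lemma exists_lift_three (hS : HasLiftingProperty S.ι p) (b : N ⟶ Y) {T₁ T₂ T₃ : SSet.{0}}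
    (t₁ : T₁ ⟶ N) (t₂ : T₂ ⟶ N) (t₃ : T₃ ⟶ N) [Mono t₁] [Mono t₂] [Mono t₃]
    (f₁ : T₁ ⟶ X) (f₂ : T₂ ⟶ X) (f₃ : T₃ ⟶ X)
    (hcov : ∀ n (x : N.obj n), x ∈ S.obj n ↔
      (∃ a, t₁.app n a = x) ∨ (∃ a, t₂.app n a = x) ∨ ∃ a, t₃.app n a = x)
    (h₁₂ : ∀ n a₁ a₂, t₁.app n a₁ = t₂.app n a₂ → f₁.app n a₁ = f₂.app n a₂)
    (h₁₃ : ∀ n a₁ a₃, t₁.app n a₁ = t₃.app n a₃ → f₁.app n a₁ = f₃.app n a₃)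
    (h₂₃ : ∀ n a₂ a₃, t₂.app n a₂ = t₃.app n a₃ → f₂.app n a₂ = f₃.app n a₃)
    (hb₁ : f₁ ≫ p = t₁ ≫ b) (hb₂ : f₂ ≫ p = t₂ ≫ b) (hb₃ : f₃ ≫ p = t₃ ≫ b) :
    ∃ L : N ⟶ X, L ≫ p = b ∧ t₁ ≫ L = f₁ ∧ t₂ ≫ L = f₂ ∧ t₃ ≫ L = f₃ := by
  obtain ⟨L, hL, hR⟩ := exists_lift_of_rel hS b
    (fun n x y => (∃ a, t₁.app n a = x ∧ f₁.app n a = y) ∨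
      (∃ a, t₂.app n a = x ∧ f₂.app n a = y) ∨ ∃ a, t₃.app n a = x ∧ f₃.app n a = y)
    (by
      rintro n m g _ _ (⟨a, rfl, rfl⟩ | ⟨a, rfl, rfl⟩ | ⟨a, rfl, rfl⟩)
      · exact .inl ⟨T₁.map g a, app_map .., app_map ..⟩
      · exact .inr (.inl ⟨T₂.map g a, app_map .., app_map ..⟩)
      · exact .inr (.inr ⟨T₃.map g a, app_map .., app_map ..⟩))
    (by
      rintro n _ _ _ (⟨a, rfl, rfl⟩ | ⟨a, rfl, rfl⟩ | ⟨a, rfl, rfl⟩)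
        (⟨a', h, rfl⟩ | ⟨a', h, rfl⟩ | ⟨a', h, rfl⟩)
      · rw [app_injective t₁ n h]
      · exact h₁₂ n _ _ h.symm
      · exact h₁₃ n _ _ h.symm
      · exact (h₁₂ n _ _ h).symm
      · rw [app_injective t₂ n h]
      · exact h₂₃ n _ _ h.symm
      · exact (h₁₃ n _ _ h).symm
      · exact (h₂₃ n _ _ h).symm
      · rw [app_injective t₃ n h])
    (by
      intro n x
      rw [hcov]
      constructor
      · rintro (⟨a, rfl⟩ | ⟨a, rfl⟩ | ⟨a, rfl⟩)
        · exact ⟨_, .inl ⟨a, rfl, rfl⟩⟩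
        · exact ⟨_, .inr (.inl ⟨a, rfl, rfl⟩)⟩
        · exact ⟨_, .inr (.inr ⟨a, rfl, rfl⟩)⟩
      · rintro ⟨_, ⟨a, h, -⟩ | ⟨a, h, -⟩ | ⟨a, h, -⟩⟩
        · exact .inl ⟨a, h⟩
        · exact .inr (.inl ⟨a, h⟩)
        · exact .inr (.inr ⟨a, h⟩))
    (by
      rintro n _ _ (⟨a, rfl, rfl⟩ | ⟨a, rfl, rfl⟩ | ⟨a, rfl, rfl⟩)
      · exact app_eq hb₁ a
      · exact app_eq hb₂ a
      · exact app_eq hb₃ a)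
  exact ⟨L, hL, hom_ext_app fun n a => hR n _ _ (.inl ⟨a, rfl, rfl⟩),
    hom_ext_app fun n a => hR n _ _ (.inr (.inl ⟨a, rfl, rfl⟩)),
    hom_ext_app fun n a => hR n _ _ (.inr (.inr ⟨a, rfl, rfl⟩))⟩

end Gluing

lemma mem_unionProd {X Y : SSet.{0}} (S : X.Subcomplex) (T : Y.Subcomplex)
    {n : SimplexCategoryᵒᵖ} (x : X.obj n) (y : Y.obj n) :
    (S.unionProd T).obj n (x, y) ↔ y ∈ T.obj n ∨ x ∈ S.obj n :=
  Subcomplex.mem_unionProd_iff S T _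

lemma mem_range_iff {X Y : SSet.{0}} (f : X ⟶ Y) {n : SimplexCategoryᵒᵖ} (y : Y.obj n) :
    y ∈ (Subcomplex.range f).obj n ↔ ∃ x, f.app n x = y := Iff.rfl

lemma const_eq_iff {n : SimplexCategoryᵒᵖ} (s : (Δ[1] : SSet.{0}).obj n) (k : Fin 2) :
    s = stdSimplex.const 1 k n ↔ ∀ j, stdSimplex.asOrderHom s j = k := by
  constructor
  · rintro rfl j
    rfl
  · intro h
    apply stdSimplex.objEquiv.injective
    apply SimplexCategory.Hom.ext
    ext j : 2
    exact h j

lemma const_ne {n : SimplexCategoryᵒᵖ} {k l : Fin 2} (h : k ≠ l) :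
    stdSimplex.const.{0} 1 k n ≠ stdSimplex.const 1 l n := fun h' =>
  h ((const_eq_iff _ l).1 h' 0)

lemma mem_horn_one_iff {n : SimplexCategoryᵒᵖ} (s : (Δ[1] : SSet.{0}).obj n) (k : Fin 2) :
    s ∈ (SSet.horn 1 k).obj n ↔ s = stdSimplex.const 1 k n := by
  rw [const_eq_iff, mem_horn_iff, ne_eq, Set.eq_univ_iff_forall, not_forall]
  simp only [Set.union_singleton, Set.mem_insert_iff, Set.mem_range, not_or, not_exists]
  constructor
  · rintro ⟨j, hj, h⟩ l
    have := h l
    generalize (stdSimplex.asOrderHom s l) = a at *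
    omega
  · intro h
    refine ⟨k.rev, ?_, fun l hl => ?_⟩
    · fin_cases k <;> decide
    · have := h l
      erw [hl] at this
      revert this
      fin_cases k <;> decide

lemma mem_boundary_one_iff {n : SimplexCategoryᵒᵖ} (s : (Δ[1] : SSet.{0}).obj n) :
    s ∈ (SSet.boundary 1).obj n ↔
      s = stdSimplex.const 1 0 n ∨ s = stdSimplex.const 1 1 n := by
  rw [const_eq_iff, const_eq_iff]
  change ¬ Function.Surjective _ ↔ _
  rw [Function.Surjective, not_forall]
  constructor
  · rintro ⟨j, hj⟩
    fin_cases j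
    · right
      intro l
      have := fun h => hj ⟨l, h⟩
      generalize (stdSimplex.asOrderHom s l) = a at *
      fin_cases a <;> simp_all
    · left
      intro l
      have := fun h => hj ⟨l, h⟩
      generalize (stdSimplex.asOrderHom s l) = a at *
      fin_cases a <;> simp_all
  · rintro (h | h)
    · refine ⟨1, fun ⟨l, hl⟩ => ?_⟩
      have := (h l).symm.trans hl
      simp at this
    · refine ⟨0, fun ⟨l, hl⟩ => ?_⟩
      have := (h l).symm.trans hl
      simp at this

lemma hasLiftingProperty_of_anodyneExtensions {A B X Y : SSet.{0}} {i : A ⟶ B} {p : X ⟶ Y}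
    (hi : anodyneExtensions i) (hp : KanFibration p) : HasLiftingProperty i p :=
  (anodyne_iff_anodyneExtensions i).2 hi p hp

/-- The homotopy extension and lifting property. -/
lemma exists_homotopy_extension (ε : Fin 2) {M N X Y : SSet.{0}} (m : M ⟶ N) [Mono m]
    {p : X ⟶ Y} (hp : KanFibration p) (a : N ⟶ X) (H : M ⊗ Δ[1] ⟶ X) (b : N ⊗ Δ[1] ⟶ Y)
    (haH : ept M ε ≫ H = m ≫ a) (hH : H ≫ p = m ▷ Δ[1] ≫ b) (ha : a ≫ p = ept N ε ≫ b) :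
    ∃ L : N ⊗ Δ[1] ⟶ X, L ≫ p = b ∧ m ▷ Δ[1] ≫ L = H ∧ ept N ε ≫ L = a := by
  have h : anodyneExtensions ((Subcomplex.range m).unionProd (SSet.horn 1 ε)).ι :=
    anodyneExtensions_unionProd_ι _ _ (anodyneExtensions.horn_ι _)
  refine exists_lift_two (hasLiftingProperty_of_anodyneExtensions h hp) b _ _ H a ?_ ?_ hH ha
  · rintro n ⟨x, s⟩
    refine (mem_unionProd _ _ x s).trans ?_
    rw [mem_horn_one_iff, mem_range_iff, or_comm]
    refine or_congr ⟨?_, ?_⟩ ⟨?_, ?_⟩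
    · rintro ⟨a, rfl⟩
      exact ⟨(a, s), rfl⟩
    · rintro ⟨⟨a, s⟩, h⟩
      exact ⟨a, congr_arg Prod.fst h⟩
    · rintro rfl
      exact ⟨x, rfl⟩
    · rintro ⟨a, h⟩
      exact (congr_arg Prod.snd h).symm
  · rintro n ⟨x, s⟩ y h
    obtain rfl : m.app n x = y := congr_arg Prod.fst h
    obtain rfl : s = _ := congr_arg Prod.snd h
    exact app_eq haH x

open CartesianMonoidalCategory (fst snd)

/-- Two lifts of the same homotopy which agree at one end are homotopic at any end. -/
lemma exists_homotopy_of_lifts (ε δ : Fin 2) {M N X Y : SSet.{0}} (m : M ⟶ N)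
    {p : X ⟶ Y} (hp : KanFibration p) (H₁ H₂ : N ⊗ Δ[1] ⟶ X)
    (hpH : H₁ ≫ p = H₂ ≫ p) (hε : ept N ε ≫ H₁ = ept N ε ≫ H₂)
    (hm : m ▷ Δ[1] ≫ H₁ = m ▷ Δ[1] ≫ H₂) :
    ∃ K : N ⊗ Δ[1] ⟶ X, ept N 0 ≫ K = ept N δ ≫ H₁ ∧ ept N 1 ≫ K = ept N δ ≫ H₂ ∧
      K ≫ p = fst N Δ[1] ≫ ept N δ ≫ H₁ ≫ p ∧
      m ▷ Δ[1] ≫ K = fst M Δ[1] ≫ m ≫ ept N δ ≫ H₁ := by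
  have h : anodyneExtensions
      (((Subcomplex.range m).unionProd (SSet.boundary 1)).unionProd (SSet.horn 1 ε)).ι :=
    anodyneExtensions_unionProd_ι _ _ (anodyneExtensions.horn_ι _)
  obtain ⟨L, hL, hR⟩ := exists_lift_of_rel (hasLiftingProperty_of_anodyneExtensions h hp)
    (fst N Δ[1] ▷ Δ[1] ≫ H₁ ≫ p)
    (fun n x y => ((x.1.2 = stdSimplex.const 1 0 n ∨ (∃ a, m.app n a = x.1.1) ∨
        x.2 = stdSimplex.const 1 ε n) ∧ H₁.app n (x.1.1, x.2) = y) ∨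
      (x.1.2 = stdSimplex.const 1 1 n ∧ H₂.app n (x.1.1, x.2) = y))
    (by
      rintro n k g ⟨⟨x, s⟩, t⟩ y (⟨h, rfl⟩ | ⟨h, rfl⟩)
      · refine .inl ⟨?_, app_map H₁ g (x, t)⟩
        rcases h with h | ⟨a, h⟩ | h <;> dsimp at h <;> subst h
        · exact .inl rfl
        · exact .inr (.inl ⟨M.map g a, app_map ..⟩)
        · exact .inr (.inr rfl)
      · dsimp at h
        subst h
        exact .inr ⟨rfl, app_map H₂ g (x, t)⟩)
    (by
      have key : ∀ n (x : N.obj n) (s t : (Δ[1] : SSet.{0}).obj n),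
          (s = stdSimplex.const 1 0 n ∨ (∃ a, m.app n a = x) ∨ t = stdSimplex.const 1 ε n) →
          s = stdSimplex.const 1 1 n → H₁.app n (x, t) = H₂.app n (x, t) := by
        rintro n x s t (h | ⟨a, rfl⟩ | rfl) h'
        · exact (const_ne (by decide : (0 : Fin 2) ≠ 1) (h.symm.trans h')).elim
        · exact app_eq hm (a, t)
        · exact app_eq hε x
      rintro n ⟨⟨x, s⟩, t⟩ y y' (⟨h, rfl⟩ | ⟨h, rfl⟩) (⟨h', rfl⟩ | ⟨h', rfl⟩)
      · rfl
      · exact key n x s t h h'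
      · exact (key n x s t h' h).symm
      · rfl)
    (by
      rintro n ⟨⟨x, s⟩, t⟩
      refine (mem_unionProd _ _ (show (N ⊗ Δ[1]).obj n from (x, s)) t).trans ?_
      rw [mem_horn_one_iff]
      refine (or_congr_right (mem_unionProd _ _ x s)).trans ?_
      rw [mem_boundary_one_iff, mem_range_iff]
      constructor
      · rintro (h | (h | h) | h)
        · exact ⟨_, .inl ⟨.inr (.inr h), rfl⟩⟩
        · exact ⟨_, .inl ⟨.inl h, rfl⟩⟩
        · exact ⟨_, .inr ⟨h, rfl⟩⟩
        · exact ⟨_, .inl ⟨.inr (.inl h), rfl⟩⟩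
      · rintro ⟨y, ⟨h | h | h, -⟩ | ⟨h, -⟩⟩
        · exact .inr (.inl (.inl h))
        · exact .inr (.inr h)
        · exact .inl h
        · exact .inr (.inl (.inr h)))
    (by
      rintro n ⟨⟨x, s⟩, t⟩ y (⟨h, rfl⟩ | ⟨h, rfl⟩)
      · rfl
      · exact (app_eq hpH (x, t)).symm)
  refine ⟨ept (N ⊗ Δ[1]) δ ≫ L, ?_, ?_, ?_, ?_⟩
  · exact hom_ext_app fun n x => hR n ((x, _), _) _ (.inl ⟨.inl rfl, rfl⟩)
  · exact hom_ext_app fun n x => hR n ((x, _), _) _ (.inr ⟨rfl, rfl⟩)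
  · rw [Category.assoc, hL]
    rfl
  · exact hom_ext_app fun n x => hR n ((_, _), _) _ (.inl ⟨.inr (.inl ⟨x.1, rfl⟩), rfl⟩)

lemma anodyneExtensions_range_ι {M N : SSet.{0}} {m : M ⟶ N} [Mono m]
    (hm : anodyneExtensions m) : anodyneExtensions (Subcomplex.range m).ι := by
  have : Mono (Subcomplex.toRange m) := mono_of_mono_fac (Subcomplex.toRange_ι m)
  have : IsIso (Subcomplex.toRange m) := isIso_of_mono_of_epi _
  exact (anodyneExtensions.arrow_mk_iso_iff (Arrow.isoMk (f := Arrow.mk m)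
    (g := Arrow.mk (Subcomplex.range m).ι) (asIso (Subcomplex.toRange m)) (Iso.refl _) rfl)).1 hm

/-- Lifting of homotopies with prescribed ends, extending a given homotopy along an
anodyne extension. -/
lemma exists_homotopy_of_anodyne {M N X Y : SSet.{0}} (m : M ⟶ N) [Mono m]
    (hm : anodyneExtensions m) {p : X ⟶ Y} (hp : KanFibration p) (f₀ f₁ : N ⟶ X)
    (H : M ⊗ Δ[1] ⟶ X) (b : N ⊗ Δ[1] ⟶ Y) (h₀ : ept M 0 ≫ H = m ≫ f₀)
    (h₁ : ept M 1 ≫ H = m ≫ f₁) (hH : H ≫ p = m ▷ Δ[1] ≫ b) (hf₀ : f₀ ≫ p = ept N 0 ≫ b)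
    (hf₁ : f₁ ≫ p = ept N 1 ≫ b) :
    ∃ L : N ⊗ Δ[1] ⟶ X, L ≫ p = b ∧ m ▷ Δ[1] ≫ L = H ∧ ept N 0 ≫ L = f₀ ∧
      ept N 1 ≫ L = f₁ := by
  have h : anodyneExtensions ((Subcomplex.range m).unionProd (SSet.boundary 1)).ι :=
    anodyneExtensions_unionProd_ι' _ _ (anodyneExtensions_range_ι hm)
  refine exists_lift_three (hasLiftingProperty_of_anodyneExtensions h hp) b _ _ _ H f₀ f₁
    ?_ ?_ ?_ ?_ hH hf₀ hf₁
  · rintro n ⟨x, s⟩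
    refine (mem_unionProd _ _ x s).trans ?_
    rw [mem_boundary_one_iff, mem_range_iff, or_comm]
    refine or_congr ⟨?_, ?_⟩ (or_congr ⟨?_, ?_⟩ ⟨?_, ?_⟩)
    · rintro ⟨a, rfl⟩
      exact ⟨(a, s), rfl⟩
    · rintro ⟨⟨a, s⟩, h⟩
      exact ⟨a, congr_arg Prod.fst h⟩
    · rintro rfl
      exact ⟨x, rfl⟩
    · rintro ⟨a, h⟩
      exact (congr_arg Prod.snd h).symm
    · rintro rfl
      exact ⟨x, rfl⟩
    · rintro ⟨a, h⟩
      exact (congr_arg Prod.snd h).symm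
  · rintro n ⟨x, s⟩ y h
    obtain rfl : m.app n x = y := congr_arg Prod.fst h
    obtain rfl : s = _ := congr_arg Prod.snd h
    exact app_eq h₀ x
  · rintro n ⟨x, s⟩ y h
    obtain rfl : m.app n x = y := congr_arg Prod.fst h
    obtain rfl : s = _ := congr_arg Prod.snd h
    exact app_eq h₁ x
  · intro n x y h
    exact (const_ne (by decide : (0 : Fin 2) ≠ 1) (congr_arg Prod.snd h)).elim

/-- Extension of a homotopy given on the union of two subobjects. -/
lemma exists_homotopy_extension_two (ε : Fin 2) {M₁ M₂ N X Y : SSet.{0}} (m₁ : M₁ ⟶ N) [Mono m₁]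
    (m₂ : M₂ ⟶ N) [Mono m₂] {p : X ⟶ Y} (hp : KanFibration p) (a : N ⟶ X)
    (H₁ : M₁ ⊗ Δ[1] ⟶ X) (H₂ : M₂ ⊗ Δ[1] ⟶ X) (b : N ⊗ Δ[1] ⟶ Y)
    (h₁₂ : ∀ n x₁ x₂ (t : (Δ[1] : SSet.{0}).obj n), m₁.app n x₁ = m₂.app n x₂ →
      H₁.app n (x₁, t) = H₂.app n (x₂, t))
    (haH₁ : ept M₁ ε ≫ H₁ = m₁ ≫ a) (haH₂ : ept M₂ ε ≫ H₂ = m₂ ≫ a)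
    (hH₁ : H₁ ≫ p = m₁ ▷ Δ[1] ≫ b) (hH₂ : H₂ ≫ p = m₂ ▷ Δ[1] ≫ b) (ha : a ≫ p = ept N ε ≫ b) :
    ∃ L : N ⊗ Δ[1] ⟶ X, L ≫ p = b ∧ m₁ ▷ Δ[1] ≫ L = H₁ ∧ m₂ ▷ Δ[1] ≫ L = H₂ ∧
      ept N ε ≫ L = a := by
  have h : anodyneExtensions
      ((Subcomplex.range m₁ ⊔ Subcomplex.range m₂).unionProd (SSet.horn 1 ε)).ι :=
    anodyneExtensions_unionProd_ι _ _ (anodyneExtensions.horn_ι _)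
  refine exists_lift_three (hasLiftingProperty_of_anodyneExtensions h hp) b _ _ _ H₁ H₂ a
    ?_ ?_ ?_ ?_ hH₁ hH₂ ha
  · rintro n ⟨x, s⟩
    refine (mem_unionProd _ _ x s).trans ?_
    rw [mem_horn_one_iff]
    constructor
    · rintro (rfl | ⟨a, rfl⟩ | ⟨a, rfl⟩)
      · exact .inr (.inr ⟨x, rfl⟩)
      · exact .inl ⟨(a, s), rfl⟩
      · exact .inr (.inl ⟨(a, s), rfl⟩)
    · rintro (⟨⟨a, t⟩, h⟩ | ⟨⟨a, t⟩, h⟩ | ⟨a, h⟩)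
      · exact .inr (.inl ⟨a, congr_arg Prod.fst h⟩)
      · exact .inr (.inr ⟨a, congr_arg Prod.fst h⟩)
      · exact .inl (congr_arg Prod.snd h).symm
  · rintro n ⟨x, s⟩ ⟨y, t⟩ h
    obtain rfl : s = t := (Prod.mk.inj h).2
    exact h₁₂ n x y s (Prod.mk.inj h).1
  · rintro n ⟨x, s⟩ y h
    obtain rfl : m₁.app n x = y := congr_arg Prod.fst h
    obtain rfl : s = _ := congr_arg Prod.snd h
    exact app_eq haH₁ x
  · rintro n ⟨x, s⟩ y h
    obtain rfl : m₂.app n x = y := congr_arg Prod.fst h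
    obtain rfl : s = _ := congr_arg Prod.snd h
    exact app_eq haH₂ x

/-! ### Codiscrete simplicial sets -/

/-- Maps `X ⟶ codisc S` correspond to arbitrary families of functions `X.obj n → S`. -/
def codisc (S : Type) : SSet.{0} where
  obj n := ∀ k : SimplexCategoryᵒᵖ, (n ⟶ k) → S
  map f := TypeCat.ofHom fun z k g => z k (f ≫ g)
  map_id n := by
    ext z k g
    exact congr_arg (z k) (Category.id_comp g)
  map_comp f g := by
    ext z k h
    exact congr_arg (z k) (Category.assoc f g h)

section Codisc

variable {S : Type}

/-- The function `S` which is associated to a simplex of `codisc S`. -/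
def codisc.code {n : SimplexCategoryᵒᵖ} (z : (codisc S).obj n) : S := z n (𝟙 n)

lemma codisc.code_map {n m : SimplexCategoryᵒᵖ} (f : n ⟶ m) (z : (codisc S).obj n) :
    codisc.code ((codisc S).map f z) = z m f :=
  congr_arg (z m) (Category.comp_id f)

/-- The map to `codisc S` given by a family of functions. -/
def codisc.mk {X : SSet.{0}} (φ : ∀ n, X.obj n → S) : X ⟶ codisc S :=
  mkHom (fun n x k g => φ k (X.map g x)) (by
    intro n m g x
    funext k f
    exact congr_arg (φ k) (map_comp_app g f x).symm)

@[simp]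
lemma codisc.code_mk_app {X : SSet.{0}} (φ : ∀ n, X.obj n → S) {n : SimplexCategoryᵒᵖ}
    (x : X.obj n) : codisc.code ((codisc.mk φ).app n x) = φ n x :=
  congr_arg (φ n) (map_id_app n x)

lemma codisc.hom_ext {X : SSet.{0}} {f g : X ⟶ codisc S}
    (h : ∀ n (x : X.obj n), codisc.code (f.app n x) = codisc.code (g.app n x)) : f = g := by
  refine hom_ext_app fun n x => funext fun k => funext fun φ => ?_
  refine (codisc.code_map φ (f.app n x)).symm.trans (.trans ?_ (codisc.code_map φ (g.app n x)))
  rw [← app_map, ← app_map, h]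

lemma toPt_uniq {X : SSet.{0}} (f g : X ⟶ Δ[0]) : f = g := by
  refine hom_ext_app fun n x => ?_
  apply stdSimplex.objEquiv.injective
  apply SimplexCategory.Hom.ext
  apply OrderHom.ext
  funext j
  exact @Subsingleton.elim (Fin 1) _ _ _

lemma codisc.hasLiftingProperty [Nonempty S] {A B : SSet.{0}} (i : A ⟶ B) [Mono i] :
    HasLiftingProperty i (toPt (codisc S)) where
  sq_hasLift {f g} sq := by
    classical
    let φ : ∀ n, B.obj n → S := fun n b => if h : ∃ a, i.app n a = b then
      codisc.code (f.app n h.choose) else Classical.arbitrary S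
    refine ⟨⟨⟨codisc.mk φ, codisc.hom_ext fun n a => ?_, toPt_uniq _ _⟩⟩⟩
    have h : ∃ a', i.app n a' = i.app n a := ⟨a, rfl⟩
    refine (codisc.code_mk_app φ (i.app n a)).trans ((dif_pos h).trans ?_)
    rw [app_injective i n h.choose_spec]

lemma codisc.kanFibration [Nonempty S] : KanFibration (toPt (codisc S)) :=
  fun _ _ => codisc.hasLiftingProperty _

lemma codisc.exists_extension [Nonempty S] {A B : SSet.{0}} (i : A ⟶ B) [Mono i]
    (f : A ⟶ codisc S) : ∃ g : B ⟶ codisc S, i ≫ g = f := by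
  have := codisc.hasLiftingProperty (S := S) i
  have sq : CommSq f i (toPt (codisc S)) (toPt B) := ⟨toPt_uniq _ _⟩
  exact ⟨sq.lift, sq.fac_left⟩

lemma codisc.exists_extension_two [Nonempty S] {T₁ T₂ N : SSet.{0}} (t₁ : T₁ ⟶ N) (t₂ : T₂ ⟶ N)
    [Mono t₁] [Mono t₂] (f₁ : T₁ ⟶ codisc S) (f₂ : T₂ ⟶ codisc S)
    (h₁₂ : ∀ n a₁ a₂, t₁.app n a₁ = t₂.app n a₂ → f₁.app n a₁ = f₂.app n a₂) :
    ∃ L : N ⟶ codisc S, t₁ ≫ L = f₁ ∧ t₂ ≫ L = f₂ := by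
  obtain ⟨L, -, h⟩ := exists_lift_two (S := Subcomplex.range t₁ ⊔ Subcomplex.range t₂)
    (codisc.hasLiftingProperty (S := S) _) (toPt N) t₁ t₂ f₁ f₂ (fun _ _ => Iff.rfl) h₁₂
    (toPt_uniq _ _) (toPt_uniq _ _)
  exact ⟨L, h⟩

end Codisc

lemma Anodyne.mono {A B : SSet.{0}} {i : A ⟶ B} (hi : Anodyne i) : Mono i := by
  let S : Type := Option (Σ n, A.obj n)
  let f : A ⟶ codisc S := codisc.mk fun n a => some ⟨n, a⟩
  have := hi _ (codisc.kanFibration (S := S))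
  have sq : CommSq f i (toPt (codisc S)) (toPt B) := ⟨toPt_uniq _ _⟩
  refine (mono_iff_app_injective i).2 fun n a a' h => ?_
  have h' : f.app n a = f.app n a' := by
    rw [← app_eq sq.fac_left a, ← app_eq sq.fac_left a']
    exact congr_arg (sq.lift.app n) h
  have := congr_arg codisc.code h'
  rw [codisc.code_mk_app, codisc.code_mk_app] at this
  simpa [S] using this

lemma isPullback_of_app {X X' Y Y' : SSet.{0}} {j : X ⟶ X'} {p : X ⟶ Y} {p' : X' ⟶ Y'}
    {i : Y ⟶ Y'} [Mono i] (hj : j ≫ p' = p ≫ i)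
    (hex : ∀ n (x' : X'.obj n) (y : Y.obj n), p'.app n x' = i.app n y → ∃ x, j.app n x = x')
    (hinj : ∀ n (x y : X.obj n), p.app n x = p.app n y → j.app n x = j.app n y → x = y) :
    IsPullback j p p' i := by
  refine IsPullback.of_forall_isPullback_app fun n => ?_
  rw [Types.isPullback_iff]
  refine ⟨congr_app hj n, fun x y h => hinj n x y h.2 h.1, fun x' y h => ?_⟩
  obtain ⟨x, rfl⟩ := hex n x' y h
  exact ⟨x, rfl, app_injective i n ((app_eq hj x).symm.trans h)⟩

/-- The product of a pullback with `Z`. -/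
lemma exists_pullback_prod {A B X : SSet.{0}} (f : B ⟶ A) (p : X ⟶ A) (Z : SSet.{0}) :
    ∃ (Q : SSet.{0}) (b : Q ⟶ B) (x : Q ⟶ X) (z : Q ⟶ Z), x ≫ p = b ≫ f ∧
      (∀ n (q q' : Q.obj n), b.app n q = b.app n q' → x.app n q = x.app n q' →
        z.app n q = z.app n q' → q = q') ∧
      (∀ n (b₀ : B.obj n) (x₀ : X.obj n) (z₀ : Z.obj n), p.app n x₀ = f.app n b₀ →
        ∃ q, b.app n q = b₀ ∧ x.app n q = x₀ ∧ z.app n q = z₀) ∧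
      (∀ ⦃W : SSet.{0}⦄ (b' : W ⟶ B) (x' : W ⟶ X) (z' : W ⟶ Z), x' ≫ p = b' ≫ f →
        ∃ k : W ⟶ Q, k ≫ b = b' ∧ k ≫ x = x' ∧ k ≫ z = z') := by
  let Q : (B ⊗ (X ⊗ Z)).Subcomplex :=
    { obj n := { q | p.app n q.2.1 = f.app n q.1 }
      map g q hq := by
        change p.app _ (X.map g q.2.1) = f.app _ (B.map g q.1)
        rw [app_map, app_map]
        exact congr_arg _ hq }
  refine ⟨Q, Q.ι ≫ fst _ _, Q.ι ≫ snd _ _ ≫ fst _ _, Q.ι ≫ snd _ _ ≫ snd _ _,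
    hom_ext_app fun n q => q.2, fun n q q' h₁ h₂ h₃ => Subtype.ext ?_,
    fun n b₀ x₀ z₀ h => ⟨⟨(b₀, x₀, z₀), h⟩, rfl, rfl, rfl⟩, ?_⟩
  · exact Prod.ext h₁ (Prod.ext h₂ h₃)
  · intro W b' x' z' h
    refine ⟨Subcomplex.lift (CartesianMonoidalCategory.lift b'
      (CartesianMonoidalCategory.lift x' z')) ?_, rfl, rfl, rfl⟩
    rintro n _ ⟨w, rfl⟩
    exact app_eq h w

lemma KanFibration.exists_homotopy_lift (ε : Fin 2) {N X Y : SSet.{0}} {p : X ⟶ Y}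
    (hp : KanFibration p) (a : N ⟶ X) (b : N ⊗ Δ[1] ⟶ Y) (ha : a ≫ p = ept N ε ≫ b) :
    ∃ L : N ⊗ Δ[1] ⟶ X, L ≫ p = b ∧ ept N ε ≫ L = a := by
  obtain ⟨L, h₁, -, h₂⟩ := exists_homotopy_extension ε (⊥ : N.Subcomplex).ι hp a
    (mkHom (fun _ x => x.1.2.elim) fun _ x => x.1.2.elim) b
    (hom_ext_app fun _ x => x.2.elim) (hom_ext_app fun _ x => x.1.2.elim) ha
  exact ⟨L, h₁, h₂⟩

/-- Extending a Kan fibration along a deformation retract `i`. -/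
lemma exists_fibration_extension {S : Type} [Nonempty S] (ε δ : Fin 2) {A B X : SSet.{0}}
    (i : A ⟶ B) [Mono i] (r : B ⟶ A) (h : A ⊗ Δ[1] ⟶ A) (hε : ept A ε ≫ h = 𝟙 A)
    (hδ : ept A δ ≫ h = i ≫ r) {p : X ⟶ A} (hp : KanFibration p) (z₀ : X ⟶ codisc S)
    (hz₀ : ∀ n (x y : X.obj n), p.app n x = p.app n y → z₀.app n x = z₀.app n y → x = y) :
    ∃ (X' : SSet.{0}) (p' : X' ⟶ B) (j : X ⟶ X') (c c' : X' ⟶ codisc S), KanFibration p' ∧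
      IsPullback j p p' i ∧ ∀ n (x y : X'.obj n), p'.app n x = p'.app n y →
        c.app n x = c.app n y → c'.app n x = c'.app n y → x = y := by
  obtain ⟨G, hG₁, hG₂⟩ := hp.exists_homotopy_lift ε (𝟙 X) (p ▷ Δ[1] ≫ h)
    (by rw [← Category.assoc, ept_whiskerRight, Category.assoc, hε]; simp)
  obtain ⟨ψ, hψ⟩ : ∃ ψ, ψ = ept X δ ≫ G := ⟨_, rfl⟩
  have hψp : ψ ≫ p = p ≫ i ≫ r := by
    rw [hψ, Category.assoc, hG₁, ← hδ, ← Category.assoc, ept_whiskerRight, Category.assoc]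
  obtain ⟨P, bP, xP, zP, hP, hP_ext, hP_ex, hP_lift⟩ := exists_pullback_prod (i ≫ r) p (codisc S)
  obtain ⟨Q, bQ, xQ, zQ, hQ, hQ_ext, -, hQ_lift⟩ := exists_pullback_prod r p (codisc S)
  obtain ⟨e, heb, hex, hez⟩ := hP_lift p ψ z₀ hψp
  obtain ⟨k, hkb, hkx, hkz⟩ := hQ_lift (bP ≫ i) xP zP (by rw [hP, Category.assoc])
  have : Mono e := (mono_iff_app_injective _).2 fun n x y hxy =>
    hz₀ n x y (by rw [← app_eq heb, ← app_eq heb]; exact congr_arg (bP.app n) hxy)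
      (by rw [← app_eq hez, ← app_eq hez]; exact congr_arg (zP.app n) hxy)
  have : Mono k := (mono_iff_app_injective _).2 fun n x y hxy =>
    hP_ext n x y
      (app_injective i n ((app_eq hkb x).symm.trans
        ((congr_arg (bQ.app n) hxy).trans (app_eq hkb y))))
      (by rw [← app_eq hkx, ← app_eq hkx]; exact congr_arg (xQ.app n) hxy)
      (by rw [← app_eq hkz, ← app_eq hkz]; exact congr_arg (zQ.app n) hxy)
  obtain ⟨H, hHp, hHe, hHδ⟩ := exists_homotopy_extension δ e hp xP G (bP ▷ Δ[1] ≫ h)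
    (by rw [hex, hψ]) (by rw [hG₁, ← heb]; simp)
    (by rw [← Category.assoc, ept_whiskerRight, Category.assoc, hδ, hP])
  obtain ⟨ρ, hρ⟩ : ∃ ρ, ρ = ept P ε ≫ H := ⟨_, rfl⟩
  have heρ : e ≫ ρ = 𝟙 X := by
    rw [hρ, ← hG₂, ← hHe, ← Category.assoc, ← Category.assoc, ept_whiskerRight]
  have hρp : ρ ≫ p = bP := by
    rw [hρ, Category.assoc, hHp, ← Category.assoc, ept_whiskerRight, Category.assoc, hε,
      Category.comp_id]
  obtain ⟨K, hK₀, hK₁, hKp, hKe⟩ := exists_homotopy_of_lifts ε δ e hp H (ρ ▷ Δ[1] ≫ G)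
    (by rw [Category.assoc, hG₁, hHp, ← hρp]; simp)
    (by rw [← Category.assoc, ept_whiskerRight, Category.assoc, hG₂, hρ, Category.comp_id])
    (by rw [hHe, ← Category.assoc, ← comp_whiskerRight, heρ]; simp)
  rw [hHδ] at hK₀
  have hK₁' : ept P 1 ≫ K = ρ ≫ ψ := by
    rw [hK₁, hψ, ← Category.assoc, ept_whiskerRight, Category.assoc]
  have hKp' : K ≫ p = fst _ _ ≫ xP ≫ p := by
    rw [hKp, ← Category.assoc (ept P δ), hHδ]
  have hKe' : ∀ n (x : X.obj n) (t : (Δ[1] : SSet.{0}).obj n),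
      K.app n (e.app n x, t) = ψ.app n x := by
    intro n x t
    refine (app_eq hKe (x, t)).trans ?_
    change (ept P δ ≫ H).app n (e.app n x) = _
    rw [hHδ]
    exact app_eq hex x
  let T : Q.Subcomplex :=
    { obj n := { q | ∀ (m : SimplexCategoryᵒᵖ) (g : n ⟶ m) (a : A.obj m),
        bQ.app m (Q.map g q) = i.app m a → ∃ x : X.obj m, p.app m x = a ∧
          ψ.app m x = xQ.app m (Q.map g q) ∧ z₀.app m x = zQ.app m (Q.map g q) }
      map f q hq m g a ha := by
        rw [← map_comp_app] at ha ⊢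
        exact hq m (f ≫ g) a ha }
  have hTk : ∀ n (q : Q.obj n) (hq : q ∈ T.obj n) (y : P.obj n), q = k.app n y →
      ∃ x : X.obj n, e.app n x = y := by
    rintro n q hq y rfl
    obtain ⟨x, hx₁, hx₂, hx₃⟩ := hq n (𝟙 n) (bP.app n y)
      (by rw [map_id_app]; exact app_eq hkb y)
    rw [map_id_app] at hx₂ hx₃
    exact ⟨x, hP_ext n _ _ ((app_eq heb x).trans hx₁)
      ((app_eq hex x).trans (hx₂.trans (app_eq hkx y)))
      ((app_eq hez x).trans (hx₃.trans (app_eq hkz y)))⟩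
  obtain ⟨L, hLp, hLT, hLk, hL₀⟩ := exists_homotopy_extension_two 0 T.ι k hp xQ
    (fst _ _ ≫ T.ι ≫ xQ) K (fst _ _ ≫ xQ ≫ p)
    (by
      rintro n ⟨q, hq⟩ y t hqy
      obtain ⟨x, rfl⟩ := hTk n q hq y hqy
      rw [hKe']
      change xQ.app n q = _
      obtain rfl : q = _ := hqy
      refine (app_eq hkx _).trans ?_
      exact app_eq hex x) rfl
    (by rw [hK₀, hkx]) rfl (by rw [hKp', ← hkx]; rfl) rfl
  obtain ⟨zR, hzRT, hzRk⟩ := codisc.exists_extension_two T.ι k (T.ι ≫ zQ) (ρ ≫ z₀)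
    (by
      rintro n ⟨q, hq⟩ y hqy
      obtain ⟨x, rfl⟩ := hTk n q hq y hqy
      obtain rfl : q = _ := hqy
      refine ((app_eq hkz _).trans (app_eq hez x)).trans ?_
      change _ = z₀.app n ((e ≫ ρ).app n x)
      rw [heρ]
      rfl)
  obtain ⟨R, hRb, hRx, hRz⟩ := hQ_lift bQ (ept Q 1 ≫ L) zR
    (by rw [Category.assoc, hLp, ← hQ]; rfl)
  have hRT : ∀ n (q : Q.obj n), R.app n q ∈ T.obj n := by
    intro n q m g a ha
    rw [← app_map] at ha ⊢
    obtain ⟨y, hy⟩ : ∃ y, k.app m y = Q.map g q := by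
      obtain ⟨y, hy₁, hy₂, hy₃⟩ := hP_ex m a (xQ.app m (Q.map g q)) (zQ.app m (Q.map g q)) (by
        refine (app_eq hQ (Q.map g q)).trans (congr_arg (r.app m) ?_)
        exact (app_eq hRb _).symm.trans ha)
      refine ⟨y, hQ_ext m _ _ ?_ ((app_eq hkx y).trans hy₂) ((app_eq hkz y).trans hy₃)⟩
      refine (app_eq hkb y).trans ((congr_arg (i.app m) hy₁).trans ?_)
      exact ha.symm.trans (app_eq hRb _)
    rw [← hy] at ha ⊢
    refine ⟨ρ.app m y, (app_eq hρp y).trans (app_injective i m ?_), ?_, ?_⟩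
    · exact (app_eq hkb y).symm.trans ((app_eq hRb _).symm.trans ha)
    · refine .trans ?_ (app_eq hRx (k.app m y)).symm
      refine (app_eq hK₁' y).symm.trans ?_
      rw [← hLk]
      rfl
    · exact (app_eq hzRk y).symm.trans (app_eq hRz (k.app m y)).symm
  have hRι : T.ι ≫ R = T.ι := by
    refine hom_ext_app fun n q => hQ_ext n _ _ ?_ ?_ ?_
    · exact app_eq hRb _
    · refine (app_eq hRx _).trans ?_
      change (ept _ 1 ≫ T.ι ▷ Δ[1] ≫ L).app n q = _
      rw [hLT]
      rfl
    · exact (app_eq hRz _).trans (app_eq hzRT q)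
  have hekT : ∀ n (x : X.obj n), (e ≫ k).app n x ∈ T.obj n := by
    intro n x m g a ha
    rw [← app_map] at ha ⊢
    have hb : bQ.app m ((e ≫ k).app m (X.map g x)) = i.app m (p.app m (X.map g x)) :=
      (app_eq hkb _).trans (congr_arg (i.app m) (app_eq heb _))
    exact ⟨X.map g x, app_injective i m (hb.symm.trans ha),
      ((app_eq hkx _).trans (app_eq hex _)).symm, ((app_eq hkz _).trans (app_eq hez _)).symm⟩
  refine ⟨T, T.ι ≫ bQ, Subcomplex.lift (e ≫ k) (by rintro n _ ⟨x, rfl⟩; exact hekT n x),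
    T.ι ≫ xQ ≫ z₀, T.ι ≫ zQ, fun n l => ⟨fun {f g} sq => ?_⟩, isPullback_of_app ?_ ?_ ?_, ?_⟩
  · have := hp n l
    have sq' : CommSq (f ≫ T.ι ≫ xQ) (SSet.horn (n + 1) l).ι p (g ≫ r) :=
      ⟨by simp only [Category.assoc, hQ]; rw [← Category.assoc, ← sq.w_assoc]; simp⟩
    obtain ⟨z', hz'⟩ := codisc.exists_extension (SSet.horn (n + 1) l).ι (f ≫ T.ι ≫ zQ)
    obtain ⟨ℓ, hℓb, hℓx, hℓz⟩ := hQ_lift g sq'.lift z' sq'.fac_right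
    have hℓ : (SSet.horn (n + 1) l).ι ≫ ℓ = f ≫ T.ι := by
      refine hom_ext_app fun m x => hQ_ext m _ _ ?_ ?_ ?_
      · exact (app_eq hℓb _).trans (app_eq sq.w x).symm
      · exact (app_eq hℓx _).trans (app_eq sq'.fac_left x)
      · exact (app_eq hℓz _).trans (app_eq hz' x)
    refine ⟨⟨⟨Subcomplex.lift (ℓ ≫ R) ?_, ?_, ?_⟩⟩⟩
    · rintro m _ ⟨x, rfl⟩
      exact hRT m _
    · rw [← cancel_mono T.ι]
      change (SSet.horn (n + 1) l).ι ≫ ℓ ≫ R = _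
      rw [reassoc_of% hℓ, hRι]
    · change (ℓ ≫ R) ≫ bQ = g
      rw [Category.assoc, hRb, hℓb]
  · change (e ≫ k) ≫ bQ = _
    rw [Category.assoc, hkb, ← heb, Category.assoc]
  · rintro n ⟨q, hq⟩ a ha
    obtain ⟨x, hx₁, hx₂, hx₃⟩ := hq n (𝟙 n) a (by rw [map_id_app]; exact ha)
    rw [map_id_app] at hx₂ hx₃
    refine ⟨x, Subtype.ext (hQ_ext n _ _ ?_ ?_ ?_)⟩
    · refine ((app_eq hkb _).trans (congr_arg (i.app n) ((app_eq heb x).trans hx₁))).trans ha.symm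
    · exact ((app_eq hkx _).trans (app_eq hex x)).trans hx₂
    · exact ((app_eq hkz _).trans (app_eq hez x)).trans hx₃
  · intro n x y _ h
    exact app_injective (e ≫ k) n (congr_arg Subtype.val h)
  · rintro n ⟨x, hx⟩ ⟨y, hy⟩ h₁ h₂ h₃
    refine Subtype.ext (hQ_ext n x y h₁ (hz₀ n _ _ ?_ h₂) h₃)
    exact (app_eq hQ x).trans ((congr_arg (r.app n) h₁).trans (app_eq hQ y).symm)

/-- The map of simplicial sets induced by a monotone map on vertices. -/
def stdSimplexProdMap {n : ℕ} (c : Fin (n + 1) × Fin 2 →o Fin (n + 1)) :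
    (Δ[n] ⊗ Δ[1] : SSet.{0}) ⟶ Δ[n] :=
  mkHom (fun _ x => stdSimplex.objMk
    (c.comp ((stdSimplex.asOrderHom x.1).prod (stdSimplex.asOrderHom x.2)))) fun _ _ => rfl

lemma asOrderHom_stdSimplexProdMap {n : ℕ} (c : Fin (n + 1) × Fin 2 →o Fin (n + 1))
    {m : SimplexCategoryᵒᵖ} (s : (Δ[n] : SSet.{0}).obj m) (t : (Δ[1] : SSet.{0}).obj m)
    (a : Fin (m.unop.len + 1)) :
    stdSimplex.asOrderHom ((stdSimplexProdMap c).app m (s, t)) a =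
      c (stdSimplex.asOrderHom s a, stdSimplex.asOrderHom t a) := rfl

lemma stdSimplex_ext {n : ℕ} {m : SimplexCategoryᵒᵖ} {s t : (Δ[n] : SSet.{0}).obj m}
    (h : ∀ a, stdSimplex.asOrderHom s a = stdSimplex.asOrderHom t a) : s = t := by
  apply stdSimplex.objEquiv.injective
  apply SimplexCategory.Hom.ext
  exact OrderHom.ext _ _ (funext h)

lemma mem_horn_iff_exists {n : ℕ} (l : Fin (n + 1)) {m : SimplexCategoryᵒᵖ}
    (s : (Δ[n] : SSet.{0}).obj m) : s ∈ (SSet.horn n l).obj m ↔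
      ∃ j, j ≠ l ∧ ∀ a, stdSimplex.asOrderHom s a ≠ j := by
  rw [mem_horn_iff, ne_eq, Set.eq_univ_iff_forall, not_forall]
  simp only [Set.union_singleton, Set.mem_insert_iff, Set.mem_range, not_or, not_exists]

lemma exists_horn_deformation_of_orderHom {n : ℕ} (l : Fin (n + 1)) (ε δ : Fin 2)
    (c : Fin (n + 1) × Fin 2 →o Fin (n + 1)) (hc : ∀ j t, c (j, t) = j ∨ c (j, t) = l)
    (hε : ∀ j, c (j, ε) = j) (j₀ : Fin (n + 1)) (hj₀ : j₀ ≠ l) (hδ : ∀ j, c (j, δ) ≠ j₀) :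
    ∃ (r : (Δ[n] : SSet.{0}) ⟶ (SSet.horn n l : SSet.{0}))
      (h : (SSet.horn n l : SSet.{0}) ⊗ Δ[1] ⟶ (SSet.horn n l : SSet.{0})),
      ept _ ε ≫ h = 𝟙 _ ∧ ept _ δ ≫ h = (SSet.horn n l).ι ≫ r := by
  refine ⟨Subcomplex.lift (ept _ δ ≫ stdSimplexProdMap c) ?_,
    Subcomplex.lift ((SSet.horn n l).ι ▷ _ ≫ stdSimplexProdMap c) ?_, ?_, rfl⟩
  · rintro m _ ⟨s, rfl⟩
    exact (mem_horn_iff_exists l _).2 ⟨j₀, hj₀, fun a => hδ _⟩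
  · rintro m _ ⟨⟨⟨s, hs⟩, t⟩, rfl⟩
    obtain ⟨j, hj, hs⟩ := (mem_horn_iff_exists l s).1 hs
    refine (mem_horn_iff_exists l _).2 ⟨j, hj, fun a h => ?_⟩
    rcases hc (stdSimplex.asOrderHom s a) (stdSimplex.asOrderHom t a) with h' | h'
    · exact hs a (h'.symm.trans h)
    · exact hj (h.symm.trans h')
  · rw [← cancel_mono (SSet.horn n l).ι]
    refine hom_ext_app fun m s => stdSimplex_ext fun a => ?_
    exact hε _

lemma exists_horn_deformation {n : ℕ} (l : Fin (n + 2)) :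
    ∃ (ε δ : Fin 2) (r : (Δ[n + 1] : SSet.{0}) ⟶ (SSet.horn (n + 1) l : SSet.{0}))
      (h : (SSet.horn (n + 1) l : SSet.{0}) ⊗ Δ[1] ⟶ (SSet.horn (n + 1) l : SSet.{0})),
      ept _ ε ≫ h = 𝟙 _ ∧ ept _ δ ≫ h = (SSet.horn (n + 1) l).ι ≫ r := by
  by_cases hl : l.1 < n + 1
  · let j₀ : Fin (n + 2) := ⟨l.1 + 1, by omega⟩
    have hj₀ : j₀.1 = l.1 + 1 := rfl
    refine ⟨1, 0, exists_horn_deformation_of_orderHom l 1 0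
      ⟨fun x => if x.1 = j₀ ∧ x.2 = 0 then l else x.1, ?_⟩ ?_ ?_ j₀ ?_ ?_⟩
    · rintro ⟨a, s⟩ ⟨b, t⟩ ⟨h₁, h₂⟩
      dsimp only at h₁ h₂ ⊢
      split_ifs <;> grind
    · intro j t
      change (if j = j₀ ∧ t = 0 then l else j) = j ∨ (if j = j₀ ∧ t = 0 then l else j) = l
      split_ifs <;> simp
    · intro j
      exact if_neg (by simp)
    · grind
    · intro j
      change (if j = j₀ ∧ (0 : Fin 2) = 0 then l else j) ≠ j₀
      split_ifs <;> grind
  · let j₀ : Fin (n + 2) := ⟨n, by omega⟩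
    have hj₀ : j₀.1 = n := rfl
    refine ⟨0, 1, exists_horn_deformation_of_orderHom l 0 1
      ⟨fun x => if x.1 = j₀ ∧ x.2 = 1 then l else x.1, ?_⟩ ?_ ?_ j₀ ?_ ?_⟩
    · rintro ⟨a, s⟩ ⟨b, t⟩ ⟨h₁, h₂⟩
      dsimp only at h₁ h₂ ⊢
      split_ifs <;> grind
    · intro j t
      change (if j = j₀ ∧ t = 1 then l else j) = j ∨ (if j = j₀ ∧ t = 1 then l else j) = l
      split_ifs <;> simp
    · intro j
      exact if_neg (by simp)
    · grind
    · intro j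
      change (if j = j₀ ∧ (1 : Fin 2) = 1 then l else j) ≠ j₀
      split_ifs <;> grind

/-! ### A universe of Kan fibrations -/

lemma exists_injective_codisc_prod (T : Type) [Nonempty T] (n : SimplexCategoryᵒᵖ) :
    ∃ e : (codisc (ℕ → T)).obj n × (codisc (ℕ → T)).obj n → ℕ → T, Function.Injective e := by
  have : Countable SimplexCategoryᵒᵖ :=
    Function.Injective.countable (f := fun k : SimplexCategoryᵒᵖ => k.unop.len) fun a b h =>
      Opposite.unop_injective (SimplexCategory.ext h)
  have (k : SimplexCategoryᵒᵖ) : Countable (n ⟶ k) :=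
    Function.Injective.countable (f := fun g : n ⟶ k => (g.unop.toOrderHom : _ → _))
      fun g g' h => Quiver.Hom.unop_inj (SimplexCategory.Hom.ext _ _ (OrderHom.ext _ _ h))
  have : Nonempty (Bool × (Σ k, n ⟶ k) × ℕ) := ⟨true, ⟨n, 𝟙 n⟩, 0⟩
  obtain ⟨g, hg⟩ := exists_surjective_nat (Bool × (Σ k, n ⟶ k) × ℕ)
  refine ⟨fun z => (fun x => (bif x.1 then z.1 else z.2) x.2.1.1 x.2.1.2 x.2.2) ∘ g,
    fun z z' h => ?_⟩
  have h' := hg.injective_comp_right h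
  refine Prod.ext (funext fun k => funext fun f => funext fun m => ?_)
    (funext fun k => funext fun f => funext fun m => ?_)
  · exact congr_fun h' (true, ⟨k, f⟩, m)
  · exact congr_fun h' (false, ⟨k, f⟩, m)

lemma isPullback_of_app' {X X' Y Y' : SSet.{0}} {j : X ⟶ X'} {p : X ⟶ Y} {p' : X' ⟶ Y'}
    {i : Y ⟶ Y'} (hj : j ≫ p' = p ≫ i)
    (hex : ∀ n (x' : X'.obj n) (y : Y.obj n), p'.app n x' = i.app n y →
      ∃ x, j.app n x = x' ∧ p.app n x = y)
    (hinj : ∀ n (x y : X.obj n), p.app n x = p.app n y → j.app n x = j.app n y → x = y) :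
    IsPullback j p p' i := by
  refine IsPullback.of_forall_isPullback_app fun n => ?_
  rw [Types.isPullback_iff]
  exact ⟨congr_app hj n, fun x y h => hinj n x y h.2 h.1, hex n⟩

lemma KanFibration.of_local {X Y : SSet.{0}} {p : X ⟶ Y}
    (h : ∀ n (g : Δ[n] ⟶ Y), ∃ (X' : SSet.{0}) (p' : X' ⟶ Δ[n]) (j : X' ⟶ X),
      IsPullback j p' p g ∧ KanFibration p') : KanFibration p := fun n l => ⟨fun {f g} sq => by
  obtain ⟨X', p', j, hj, hp'⟩ := h (n + 1) g
  have := hp' n l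
  have sq' : CommSq (hj.lift f _ sq.w) (SSet.horn (n + 1) l).ι p' (𝟙 _) := ⟨by simp⟩
  exact ⟨⟨⟨sq'.lift ≫ j, by simp, by simp [hj.w]⟩⟩⟩⟩

variable {S : Type}

/-- Subcomplexes of `Y ⊗ codisc S` which are small models of Kan fibrations over `Y`. -/
structure IsGood {Y : SSet.{0}} (A : (Y ⊗ codisc S).Subcomplex) : Prop where
  kan : KanFibration (A.ι ≫ fst Y (codisc S))
  ext : ∀ n (y : Y.obj n) (z z' : (codisc S).obj n), A.obj n (y, z) → A.obj n (y, z') →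
    codisc.code z = codisc.code z' → z = z'

/-- Base change of subcomplexes of `Y ⊗ codisc S`. -/
def restr {Y Y' : SSet.{0}} (g : Y' ⟶ Y) (A : (Y ⊗ codisc S).Subcomplex) :
    (Y' ⊗ codisc S).Subcomplex := A.preimage (g ▷ codisc S)

lemma restr_comp {Y Y' Y'' : SSet.{0}} (g : Y' ⟶ Y) (g' : Y'' ⟶ Y')
    (A : (Y ⊗ codisc S).Subcomplex) : restr (g' ≫ g) A = restr g' (restr g A) := rfl

lemma isPullback_restr {Y Y' : SSet.{0}} (g : Y' ⟶ Y) (A : (Y ⊗ codisc S).Subcomplex) :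
    ∃ j : (restr g A : SSet) ⟶ A,
      IsPullback j ((restr g A).ι ≫ fst _ _) (A.ι ≫ fst _ _) g := by
  refine ⟨Subcomplex.lift ((restr g A).ι ≫ g ▷ codisc S) ?_, isPullback_of_app' rfl ?_ ?_⟩
  · rintro n _ ⟨⟨x, hx⟩, rfl⟩
    exact hx
  · rintro n ⟨⟨x, z⟩, hx⟩ y h
    obtain rfl : x = g.app n y := h
    exact ⟨⟨(y, z), hx⟩, rfl, rfl⟩
  · rintro n ⟨⟨x, z⟩, hx⟩ ⟨⟨x', z'⟩, hx'⟩ h h'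
    exact Subtype.ext (Prod.ext h (congr_arg (fun y => y.1.2) h'))

lemma IsGood.restr {Y Y' : SSet.{0}} (g : Y' ⟶ Y) {A : (Y ⊗ codisc S).Subcomplex}
    (hA : IsGood A) : IsGood (restr g A) where
  kan := by
    obtain ⟨j, hj⟩ := isPullback_restr g A
    exact hA.kan.of_isPullback hj
  ext n y z z' h h' := hA.ext n (g.app n y) z z' h h'

/-- The universe of Kan fibrations. -/
def univ (S : Type) : SSet.{0} where
  obj n := { A : (SSet.stdSimplex.obj n.unop ⊗ codisc S).Subcomplex // IsGood A }
  map f := TypeCat.ofHom fun A => ⟨restr (SSet.stdSimplex.map f.unop) A.1, A.2.restr _⟩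
  map_id n := by
    ext ⟨A, hA⟩
    change _ ∈ (restr (SSet.stdSimplex.map (𝟙 n.unop)) A).obj _ ↔ _
    rw [show SSet.stdSimplex.map (𝟙 n.unop) = 𝟙 (SSet.stdSimplex.obj n.unop) from
      CategoryTheory.Functor.map_id _ _]
    rfl
  map_comp f g := by
    ext ⟨A, hA⟩
    change _ ∈ (restr (SSet.stdSimplex.map (g.unop ≫ f.unop)) A).obj _ ↔ _
    rw [show SSet.stdSimplex.map (g.unop ≫ f.unop) = SSet.stdSimplex.map g.unop ≫
      SSet.stdSimplex.map f.unop from CategoryTheory.Functor.map_comp _ _ _]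
    rfl

/-- The subcomplex underlying a simplex of the universe. -/
def univ.val {n : SimplexCategoryᵒᵖ} (A : (univ S).obj n) :
    (SSet.stdSimplex.obj n.unop ⊗ codisc S).Subcomplex :=
  Subtype.val A

lemma univ.val_injective {n : SimplexCategoryᵒᵖ} :
    Function.Injective (univ.val (S := S) (n := n)) :=
  Subtype.val_injective

lemma univ.isGood_val {n : SimplexCategoryᵒᵖ} (A : (univ S).obj n) : IsGood (univ.val A) :=
  Subtype.property A

/-- The simplex of `univ` classifying a Kan fibration. -/
def univ.mk {Y : SSet.{0}} (A : (Y ⊗ codisc S).Subcomplex) (hA : IsGood A) : Y ⟶ univ S :=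
  mkHom (fun n y => show { A : (SSet.stdSimplex.obj n.unop ⊗ codisc S).Subcomplex // IsGood A }
      from ⟨restr (SSet.yonedaEquiv.symm y) A, hA.restr _⟩) (by
    intro n m g y
    apply Subtype.ext
    change _ = restr (SSet.stdSimplex.map g.unop) (restr (SSet.yonedaEquiv.symm y) A)
    rw [← restr_comp, yonedaEquiv_symm_naturality_left]
    rfl)

lemma univ.val_mk_app {Y : SSet.{0}} (A : (Y ⊗ codisc S).Subcomplex) (hA : IsGood A)
    {n : SimplexCategoryᵒᵖ} (y : Y.obj n) :
    univ.val ((univ.mk A hA).app n y) = restr (SSet.yonedaEquiv.symm y) A := rfl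

lemma univ.mem_val_map {n m : SimplexCategoryᵒᵖ} (f : n ⟶ m) (A : (univ S).obj n)
    (z : (codisc S).obj m) :
    (univ.val ((univ S).map f A)).obj m (stdSimplex.objEquiv.symm (𝟙 _), z) ↔
      (univ.val A).obj m (stdSimplex.objEquiv.symm f.unop, z) := by
  change (univ.val A).obj m (stdSimplex.objEquiv.symm (𝟙 _ ≫ f.unop), z) ↔ _
  rw [Category.id_comp]

/-- The subcomplex which is classified by a map to the universe. -/
def univ.sub {Y : SSet.{0}} (c : Y ⟶ univ S) : (Y ⊗ codisc S).Subcomplex where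
  obj n := { x | (univ.val (c.app n x.1)).obj n (stdSimplex.objEquiv.symm (𝟙 _), x.2) }
  map {n m} f x hx := by
    change (univ.val (c.app m (Y.map f x.1))).obj m _
    rw [app_map]
    refine (univ.mem_val_map f _ _).2 ?_
    have := (univ.val (c.app n x.1)).map f hx
    change (univ.val (c.app n x.1)).obj m (stdSimplex.objEquiv.symm (f.unop ≫ 𝟙 _), _) at this
    rwa [Category.comp_id] at this

lemma univ.restr_sub {Y : SSet.{0}} (c : Y ⟶ univ S) {n : SimplexCategoryᵒᵖ} (y : Y.obj n) :
    restr (SSet.yonedaEquiv.symm y) (univ.sub c) = univ.val (c.app n y) := by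
  ext m ⟨s, z⟩
  obtain ⟨s, rfl⟩ := stdSimplex.objEquiv.symm.surjective s
  change (univ.val (c.app m (Y.map s.op y))).obj m _ ↔ _
  rw [app_map]
  exact univ.mem_val_map s.op _ _

lemma univ.isGood_sub {Y : SSet.{0}} (c : Y ⟶ univ S) : IsGood (univ.sub c) where
  kan := .of_local fun _ g => by
    obtain ⟨y, rfl⟩ := SSet.yonedaEquiv.symm.surjective g
    obtain ⟨j, hj⟩ := isPullback_restr (SSet.yonedaEquiv.symm y) (univ.sub c)
    refine ⟨_, _, j, hj, ?_⟩
    rw [univ.restr_sub]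
    exact (univ.isGood_val _).kan
  ext n y z z' h h' := (univ.isGood_val (c.app n y)).ext n _ z z' h h'

lemma univ.sub_mk {Y : SSet.{0}} (A : (Y ⊗ codisc S).Subcomplex) (hA : IsGood A) :
    univ.sub (univ.mk A hA) = A := by
  ext n ⟨y, z⟩
  change (univ.val ((univ.mk A hA).app n y)).obj n (_, z) ↔ A.obj n (y, z)
  rw [univ.val_mk_app]
  change A.obj n (Y.map (𝟙 _) y, z) ↔ A.obj n (y, z)
  rw [map_id_app]

lemma univ.mk_sub {Y : SSet.{0}} (c : Y ⟶ univ S) : univ.mk (univ.sub c) (univ.isGood_sub c) = c :=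
  hom_ext_app fun _ y => univ.val_injective (univ.restr_sub c y)

lemma univ.sub_comp {Y Y' : SSet.{0}} (g : Y' ⟶ Y) (c : Y ⟶ univ S) :
    univ.sub (g ≫ c) = restr g (univ.sub c) := rfl

lemma univ.sub_injective {Y : SSet.{0}} {c c' : Y ⟶ univ S} (h : univ.sub c = univ.sub c') :
    c = c' := by
  rw [← univ.mk_sub c, ← univ.mk_sub c']
  congr 1

lemma exists_isGood {X Y : SSet.{0}} {p : X ⟶ Y} (hp : KanFibration p) (s : ∀ n, X.obj n → S)
    (hs : ∀ n (x x' : X.obj n), p.app n x = p.app n x' → s n x = s n x' → x = x') :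
    ∃ (A : (Y ⊗ codisc S).Subcomplex) (e : X ≅ A), IsGood A ∧ e.hom ≫ A.ι ≫ fst _ _ = p ∧
      ∀ n (y : Y.obj n) (z : (codisc S).obj n), A.obj n (y, z) ↔
        ∃ x : X.obj n, p.app n x = y ∧ (codisc.mk s).app n x = z := by
  have hs' : ∀ n (x x' : X.obj n), p.app n x = p.app n x' → codisc.code ((codisc.mk s).app n x) =
      codisc.code ((codisc.mk s).app n x') → x = x' := by
    intro n x x' h h'
    rw [codisc.code_mk_app, codisc.code_mk_app] at h'
    exact hs n x x' h h'
  let f : X ⟶ Y ⊗ codisc S := CartesianMonoidalCategory.lift p (codisc.mk s)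
  have : Mono f := (mono_iff_app_injective _).2 fun n x x' h =>
    hs' n x x' (congr_arg Prod.fst h) (congr_arg (fun y => codisc.code y.2) h)
  refine ⟨Subcomplex.range f, asIso (Subcomplex.toRange f), ⟨?_, ?_⟩, ?_, ?_⟩
  · refine hp.of_isPullback (p := p) (f := inv (Subcomplex.toRange f)) (g := 𝟙 _)
      (IsPullback.of_horiz_isIso ⟨?_⟩)
    rw [IsIso.inv_comp_eq]
    rfl
  · rintro n y _ _ ⟨x, hx⟩ ⟨x', hx'⟩ h
    obtain ⟨rfl, rfl⟩ := Prod.mk.inj hx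
    obtain ⟨h₁, rfl⟩ := Prod.mk.inj hx'
    rw [hs' n x x' h₁.symm h]
  · rfl
  · intro n y z
    exact exists_congr fun x => Prod.mk_inj

lemma univ.exists_extension {A B : SSet.{0}} {i : A ⟶ B} {c : A ⟶ univ S} {X : SSet.{0}}
    {p : X ⟶ B} (hp : KanFibration p) {j : (univ.sub c : SSet) ⟶ X}
    (hj : IsPullback j ((univ.sub c).ι ≫ fst _ _) p i) (s : ∀ n, X.obj n → S)
    (hs : ∀ n (x x' : X.obj n), p.app n x = p.app n x' → s n x = s n x' → x = x')
    (hjs : ∀ n (x : (univ.sub c : SSet).obj n), s n (j.app n x) = codisc.code x.1.2) :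
    ∃ c' : B ⟶ univ S, i ≫ c' = c := by
  obtain ⟨A', -, hA', -, hmem⟩ := exists_isGood hp s hs
  have hjs' : j ≫ codisc.mk s = (univ.sub c).ι ≫ snd _ _ := codisc.hom_ext fun n x =>
    (codisc.code_mk_app s (j.app n x)).trans (hjs n x)
  refine ⟨univ.mk A' hA', univ.sub_injective ?_⟩
  rw [univ.sub_comp, univ.sub_mk]
  ext n ⟨a, z⟩
  refine (hmem n (i.app n a) z).trans ⟨?_, fun h => ?_⟩
  · rintro ⟨x', hx', rfl⟩
    obtain ⟨x, rfl, rfl⟩ :=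
      ((Types.isPullback_iff _ _ _ _).1 (hj.map ((evaluation _ _).obj n))).2.2 x' a hx'
    have := x.2
    exact (app_eq hjs' x).symm ▸ x.2
  · exact ⟨j.app n ⟨(a, z), h⟩, app_eq hj.w _, app_eq hjs' ⟨(a, z), h⟩⟩

lemma univ.kanComplex (T : Type) [Nonempty T] : KanComplex (univ (ℕ → T)) := fun n l => ⟨by
  classical
  intro c b sq
  suffices h : ∃ c' : Δ[n + 1] ⟶ univ (ℕ → T), (SSet.horn (n + 1) l).ι ≫ c' = c by
    obtain ⟨c', h⟩ := h
    exact ⟨⟨⟨c', h, toPt_uniq _ _⟩⟩⟩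
  obtain ⟨ε, δ, r, h, hε, hδ⟩ := exists_horn_deformation l
  obtain ⟨X', p', j, d, d', hp', hj, hd⟩ := exists_fibration_extension ε δ _ r h hε hδ
    (univ.isGood_sub c).kan ((univ.sub c).ι ≫ snd _ _) (by
      rintro n ⟨⟨y, z⟩, hx⟩ ⟨⟨y', z'⟩, hx'⟩ h h'
      exact Subtype.ext (Prod.ext h h'))
  choose e he using exists_injective_codisc_prod T
  have : Mono j := (MorphismProperty.monomorphisms SSet.{0}).of_isPullback hj.flip
    (show Mono _ from inferInstance)
  have hj' := fun k => (Types.isPullback_iff _ _ _ _).1 (hj.map ((evaluation _ _).obj k))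
  refine univ.exists_extension hp' hj (fun k x => if h : ∃ a, j.app k a = x then
    codisc.code h.choose.1.2 else e k (d.app k x, d'.app k x)) ?_ ?_
  · intro k x x' hx
    have hiff : (∃ a, j.app k a = x) ↔ ∃ a, j.app k a = x' := by
      constructor
      · rintro ⟨a, rfl⟩
        obtain ⟨a', h, -⟩ := (hj' k).2.2 x' _ (hx.symm.trans (app_eq hj.w a))
        exact ⟨a', h⟩
      · rintro ⟨a, rfl⟩
        obtain ⟨a', h, -⟩ := (hj' k).2.2 x _ (hx.trans (app_eq hj.w a))
        exact ⟨a', h⟩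
    by_cases h : ∃ a, j.app k a = x
    · have h' := hiff.1 h
      rw [dif_pos h, dif_pos h']
      intro hcode
      have ha := h.choose_spec
      have ha' := h'.choose_spec
      generalize h.choose = a at *
      generalize h'.choose = a' at *
      subst ha ha'
      obtain ⟨⟨y, z⟩, hz⟩ := a
      obtain ⟨⟨y', z'⟩, hz'⟩ := a'
      obtain rfl : y = y' := app_injective (SSet.horn (n + 1) l).ι k
        ((app_eq hj.w ⟨(y, z), hz⟩).symm.trans (hx.trans (app_eq hj.w ⟨(y', z'), hz'⟩)))
      obtain rfl := (univ.isGood_sub c).ext k y z z' hz hz' hcode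
      rfl
    · rw [dif_neg h, dif_neg fun h' => h (hiff.2 h')]
      intro hcode
      have := he k hcode
      exact hd k x x' hx (Prod.mk.inj this).1 (Prod.mk.inj this).2
  · intro k x
    have h : ∃ a, j.app k a = j.app k x := ⟨x, rfl⟩
    rw [dif_pos h, app_injective j k h.choose_spec]⟩

/-- Kan fibrations extend along anodyne maps. -/
lemma KanFibration.exists_extension {X Y Y' : SSet.{0}} {p : X ⟶ Y} (hp : KanFibration p)
    {j : Y ⟶ Y'} (hj : Anodyne j) : ∃ (X' : SSet.{0}) (p' : X' ⟶ Y') (u : X ⟶ X'),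
      KanFibration p' ∧ IsPullback u p p' j := by
  let T : Type := Option (Σ n, X.obj n)
  obtain ⟨A, e, hA, he, -⟩ := exists_isGood (S := ℕ → T) hp (fun n x _ => some ⟨n, x⟩)
    fun n x x' _ h => by
      simpa using congr_fun h 0
  have := hj _ (univ.kanComplex T)
  have sq : CommSq (univ.mk A hA) j (toPt (univ (ℕ → T))) (toPt Y') := ⟨toPt_uniq _ _⟩
  have hv := isPullback_restr j (univ.sub sq.lift)
  rw [← univ.sub_comp, sq.fac_left, univ.sub_mk] at hv
  obtain ⟨v, hv⟩ := hv
  have he' : IsPullback e.hom p (A.ι ≫ fst _ _) (𝟙 Y) := IsPullback.of_horiz_isIso ⟨he⟩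
  exact ⟨_, _, e.hom ≫ v, (univ.isGood_sub sq.lift).kan,
    by simpa using he'.paste_horiz hv⟩

/-! ### Weak homotopy equivalences and homotopy classes of maps -/

lemma Homotopic.of_forall {X Y X' Y' : SSet.{0}} (φ : (X ⟶ Y) → (X' ⟶ Y'))
    (hφ : ∀ f g, Homotopy f g → Homotopy (φ f) (φ g)) {f g : X ⟶ Y} (h : Homotopic f g) :
    Homotopic (φ f) (φ g) := by
  induction h with
  | rel f g h => exact .rel _ _ (hφ f g h)
  | refl f => exact .refl _
  | symm f g _ h => exact h.symm
  | trans f g k _ _ h h' => exact h.trans _ _ _ h'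

lemma Homotopic.precomp {X Y Z : SSet.{0}} (k : X ⟶ Y) {f g : Y ⟶ Z} (h : Homotopic f g) :
    Homotopic (k ≫ f) (k ≫ g) := by
  refine h.of_forall (fun f => k ≫ f) ?_
  rintro _ _ ⟨H, rfl, rfl⟩
  exact ⟨k ▷ Δ[1] ≫ H, rfl, rfl⟩

lemma Homotopic.postcomp {X Y Z : SSet.{0}} {f g : X ⟶ Y} (h : Homotopic f g) (k : Y ⟶ Z) :
    Homotopic (f ≫ k) (g ≫ k) := by
  refine h.of_forall (fun f => f ≫ k) ?_
  rintro _ _ ⟨H, rfl, rfl⟩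
  exact ⟨H ≫ k, rfl, rfl⟩

/-- Precomposition with `f` is bijective on homotopy classes of maps to Kan complexes. -/
structure BijectiveOnClasses {X Y : SSet.{0}} (f : X ⟶ Y) : Prop where
  surj : ∀ ⦃K : SSet.{0}⦄, KanComplex K → ∀ g : X ⟶ K, ∃ h : Y ⟶ K, Homotopic (f ≫ h) g
  inj : ∀ ⦃K : SSet.{0}⦄, KanComplex K → ∀ h h' : Y ⟶ K, Homotopic (f ≫ h) (f ≫ h') →
    Homotopic h h'

namespace BijectiveOnClasses

variable {X Y Z : SSet.{0}} {f : X ⟶ Y} {g : Y ⟶ Z}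

lemma id (X : SSet.{0}) : BijectiveOnClasses (𝟙 X) where
  surj _ _ g := ⟨g, .refl _⟩
  inj _ _ _ _ h := h

lemma comp (hf : BijectiveOnClasses f) (hg : BijectiveOnClasses g) :
    BijectiveOnClasses (f ≫ g) where
  surj K hK k := by
    obtain ⟨h, hh⟩ := hf.surj hK k
    obtain ⟨l, hl⟩ := hg.surj hK h
    exact ⟨l, (hl.precomp f).trans _ _ _ hh⟩
  inj K hK h h' H := hg.inj hK _ _ (hf.inj hK _ _ H)

lemma of_comp_left (hf : BijectiveOnClasses f) (hfg : BijectiveOnClasses (f ≫ g)) :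
    BijectiveOnClasses g where
  surj K hK k := by
    obtain ⟨h, hh⟩ := hfg.surj hK (f ≫ k)
    exact ⟨h, hf.inj hK _ _ hh⟩
  inj K hK h h' H := hfg.inj hK _ _ (H.precomp f)

lemma of_comp_right (hg : BijectiveOnClasses g) (hfg : BijectiveOnClasses (f ≫ g)) :
    BijectiveOnClasses f where
  surj K hK k := by
    obtain ⟨h, hh⟩ := hfg.surj hK k
    exact ⟨g ≫ h, hh⟩
  inj K hK h h' H := by
    obtain ⟨k, hk⟩ := hg.surj hK h
    obtain ⟨k', hk'⟩ := hg.surj hK h'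
    have := hfg.inj hK k k' (((hk.precomp f).trans _ _ _ H).trans _ _ _ (hk'.precomp f).symm)
    exact (hk.symm.trans _ _ _ (this.precomp g)).trans _ _ _ hk'

end BijectiveOnClasses

/-- The point of `K ^ Y` corresponding to a map `Y ⟶ K`. -/
noncomputable def point {Y K : SSet.{0}} (h : Y ⟶ K) : 𝟙_ SSet.{0} ⟶ (ihom Y).obj K :=
  MonoidalClosed.curry (fst Y (𝟙_ _) ≫ h)

/-- The map `Y ⟶ K` corresponding to a point of `K ^ Y`. -/
noncomputable def ofPoint {Y K : SSet.{0}} (v : 𝟙_ SSet.{0} ⟶ (ihom Y).obj K) : Y ⟶ K :=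
  CartesianMonoidalCategory.lift (𝟙 Y) (CartesianMonoidalCategory.toUnit Y) ≫
    MonoidalClosed.uncurry v

lemma ofPoint_point {Y K : SSet.{0}} (h : Y ⟶ K) : ofPoint (point h) = h := by
  rw [ofPoint, point, MonoidalClosed.uncurry_curry]
  rfl

lemma point_comp_pre {X Y K : SSet.{0}} (f : X ⟶ Y) (h : Y ⟶ K) :
    point h ≫ (MonoidalClosed.pre f).app K = point (f ≫ h) := by
  rw [point, MonoidalClosed.curry_pre_app]
  rfl

lemma ofPoint_comp_pre {X Y K : SSet.{0}} (f : X ⟶ Y) (v : 𝟙_ SSet.{0} ⟶ (ihom Y).obj K) :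
    ofPoint (v ≫ (MonoidalClosed.pre f).app K) = f ≫ ofPoint v := by
  obtain ⟨v, rfl⟩ : ∃ v', v = MonoidalClosed.curry v' :=
    ⟨_, (MonoidalClosed.curry_uncurry v).symm⟩
  rw [MonoidalClosed.curry_pre_app, ofPoint, ofPoint, MonoidalClosed.uncurry_curry,
    MonoidalClosed.uncurry_curry]
  rfl

lemma Homotopic.point {Y K : SSet.{0}} {h h' : Y ⟶ K} (H : Homotopic h h') :
    Homotopic (point h) (point h') := by
  refine H.of_forall _ ?_
  rintro _ _ ⟨H, rfl, rfl⟩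
  refine ⟨MonoidalClosed.curry (Y ◁ snd (𝟙_ _) Δ[1] ≫ H), ?_, ?_⟩ <;>
  · rw [← MonoidalClosed.curry_natural_left]
    rfl

lemma Homotopic.ofPoint {Y K : SSet.{0}} {v v' : 𝟙_ SSet.{0} ⟶ (ihom Y).obj K}
    (H : Homotopic v v') : Homotopic (ofPoint v) (ofPoint v') := by
  refine H.of_forall _ ?_
  rintro _ _ ⟨H, rfl, rfl⟩
  refine ⟨Y ◁ CartesianMonoidalCategory.lift (CartesianMonoidalCategory.toUnit _) (𝟙 Δ[1]) ≫
    MonoidalClosed.uncurry H, ?_, ?_⟩ <;>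
  · rw [Paper.ofPoint, MonoidalClosed.uncurry_natural_left]
    rfl

lemma WeakHomotopyEquivalence.bijectiveOnClasses {X Y : SSet.{0}} {f : X ⟶ Y}
    (hf : WeakHomotopyEquivalence f) : BijectiveOnClasses f where
  surj K hK g := by
    obtain ⟨G, -, hG⟩ := hf K hK
    refine ⟨ofPoint (point g ≫ G), ?_⟩
    rw [← ofPoint_comp_pre, Category.assoc]
    simpa [ofPoint_point] using (hG.precomp (point g)).ofPoint
  inj K hK h h' H := by
    obtain ⟨G, hG, -⟩ := hf K hK
    have H' := H.point.postcomp G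
    rw [← point_comp_pre, ← point_comp_pre, Category.assoc, Category.assoc] at H'
    have := ((hG.precomp (point h)).symm.trans _ _ _ H').trans _ _ _ (hG.precomp (point h'))
    simpa [ofPoint_point] using Homotopic.ofPoint this

/-! ### Anodyne maps are weak homotopy equivalences -/

lemma hasLiftingProperty_pre_app {A B K M N : SSet.{0}} {m : A ⟶ B} [Mono m]
    (hm : anodyneExtensions m) (hK : KanComplex K) (i : M ⟶ N) [Mono i] :
    HasLiftingProperty i ((MonoidalClosed.pre m).app K) where
  sq_hasLift {a b} sq := by
    obtain ⟨a, rfl⟩ : ∃ a', a = MonoidalClosed.curry a' :=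
      ⟨_, (MonoidalClosed.curry_uncurry a).symm⟩
    obtain ⟨b, rfl⟩ : ∃ b', b = MonoidalClosed.curry b' :=
      ⟨_, (MonoidalClosed.curry_uncurry b).symm⟩
    have hab : m ▷ M ≫ a = A ◁ i ≫ b := by
      apply MonoidalClosed.curry_injective
      rw [← MonoidalClosed.curry_pre_app, MonoidalClosed.curry_natural_left]
      exact sq.w
    have h : anodyneExtensions ((Subcomplex.range m).unionProd (Subcomplex.range i)).ι :=
      anodyneExtensions_unionProd_ι' _ _ (anodyneExtensions_range_ι hm)
    obtain ⟨L, -, hLm, hLi⟩ := exists_lift_two (hasLiftingProperty_of_anodyneExtensions h hK)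
      (toPt _) (m ▷ N) (B ◁ i) b a (by
        rintro n ⟨x, y⟩
        refine (mem_unionProd _ _ x y).trans ?_
        rw [mem_range_iff, mem_range_iff, or_comm]
        refine or_congr ⟨?_, ?_⟩ ⟨?_, ?_⟩
        · rintro ⟨a, rfl⟩
          exact ⟨(a, y), rfl⟩
        · rintro ⟨a, h⟩
          exact ⟨a.1, congr_arg Prod.fst h⟩
        · rintro ⟨a, rfl⟩
          exact ⟨(x, a), rfl⟩
        · rintro ⟨a, h⟩
          exact ⟨a.2, congr_arg Prod.snd h⟩)
      (by
        rintro n ⟨x, y⟩ ⟨x', y'⟩ h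
        obtain rfl : m.app n x = x' := congr_arg Prod.fst h
        obtain rfl : y = i.app n y' := congr_arg Prod.snd h
        exact (app_eq hab (x, y')).symm) (toPt_uniq _ _) (toPt_uniq _ _)
    refine ⟨⟨⟨MonoidalClosed.curry L, ?_, ?_⟩⟩⟩
    · rw [← MonoidalClosed.curry_natural_left, hLi]
    · rw [MonoidalClosed.curry_pre_app, hLm]

lemma homotopyEquivalence_of_hasLiftingProperty {X Y : SSet.{0}} {p : X ⟶ Y}
    (hp : ∀ ⦃M N : SSet.{0}⦄ (i : M ⟶ N) [Mono i], HasLiftingProperty i p) :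
    HomotopyEquivalence p := by
  obtain ⟨s, hs, -, -⟩ := exists_lift_two (hp (⊥ : Y.Subcomplex).ι) (𝟙 Y)
    (⊥ : Y.Subcomplex).ι (⊥ : Y.Subcomplex).ι (mkHom (fun _ x => x.2.elim) fun _ x => x.2.elim)
    (mkHom (fun _ x => x.2.elim) fun _ x => x.2.elim)
    (fun n x => ⟨fun h => h.elim, by rintro (⟨a, -⟩ | ⟨a, -⟩) <;> exact a.2.elim⟩)
    (fun _ a => a.2.elim) (hom_ext_app fun _ x => x.2.elim) (hom_ext_app fun _ x => x.2.elim)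
  obtain ⟨H, -, h₀, h₁⟩ := exists_lift_two
    (hp (Subcomplex.range (ept X 0) ⊔ Subcomplex.range (ept X 1)).ι) (fst X Δ[1] ≫ p)
    (ept X 0) (ept X 1) (p ≫ s) (𝟙 X) (fun _ _ => Iff.rfl)
    (fun n a b h => (const_ne (by simp) (congr_arg Prod.snd h)).elim)
    (by rw [Category.assoc, hs]; rfl) rfl
  exact ⟨s, .rel _ _ ⟨H, h₀, h₁⟩, by rw [hs]; exact .refl _⟩

lemma Anodyne.weakHomotopyEquivalence {A B : SSet.{0}} {i : A ⟶ B} (hi : Anodyne i) :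
    WeakHomotopyEquivalence i := fun K hK => by
  have := hi.mono
  exact homotopyEquivalence_of_hasLiftingProperty fun M N j _ =>
    hasLiftingProperty_pre_app ((anodyne_iff_anodyneExtensions i).1 hi) hK j

/-! ### Kan fibrations which are weak homotopy equivalences -/

lemma exists_factorization {X Y : SSet.{0}} (f : X ⟶ Y) : ∃ (Z : SSet.{0}) (i : X ⟶ Z)
    (p : Z ⟶ Y), Anodyne i ∧ KanFibration p ∧ i ≫ p = f := by
  let d := MorphismProperty.factorizationData modelCategoryQuillen.J.{0}.rlp.llp
    modelCategoryQuillen.J.{0}.rlp f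
  exact ⟨d.Z, d.i, d.p, fun _ _ q hq => d.hi q ((kanFibration_iff q).1 hq),
    (kanFibration_iff _).2 d.hp, d.fac⟩

lemma KanFibration.exists_lift_iff_of_homotopic {N X Y : SSet.{0}} {p : X ⟶ Y}
    (hp : KanFibration p) {f g : N ⟶ Y} (h : Homotopic f g) :
    (∃ σ : N ⟶ X, σ ≫ p = f) ↔ ∃ σ : N ⟶ X, σ ≫ p = g := by
  induction h with
  | rel f g h =>
    obtain ⟨H, rfl, rfl⟩ := h
    constructor
    · rintro ⟨σ, hσ⟩
      obtain ⟨L, hL, -⟩ := hp.exists_homotopy_lift 0 σ H hσ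
      exact ⟨ept N 1 ≫ L, by rw [Category.assoc, hL]⟩
    · rintro ⟨σ, hσ⟩
      obtain ⟨L, hL, -⟩ := hp.exists_homotopy_lift 1 σ H hσ
      exact ⟨ept N 0 ≫ L, by rw [Category.assoc, hL]⟩
  | refl f => rfl
  | symm f g _ h => exact h.symm
  | trans f g k _ _ h h' => exact h.trans h'

lemma KanFibration.exists_section {X Y : SSet.{0}} {p : X ⟶ Y} (hp : KanFibration p)
    (hp' : BijectiveOnClasses p) : ∃ s : Y ⟶ X, s ≫ p = 𝟙 Y := by
  obtain ⟨Y', j, q, hj, hq, -⟩ := exists_factorization (toPt Y)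
  obtain rfl : q = toPt Y' := toPt_uniq _ _
  obtain ⟨X', r, u, hr, hu⟩ := hp.exists_extension hj
  have hX' : KanComplex X' := by
    have := hr.comp hq
    rwa [toPt_uniq (r ≫ toPt Y') (toPt X')] at this
  obtain ⟨s, hs⟩ := hp'.surj hX' u
  have hs' : Homotopic (s ≫ r) j := hp'.inj hq _ _ (by
    have := hs.postcomp r
    rwa [hu.w, Category.assoc] at this)
  obtain ⟨σ, hσ⟩ := (hr.exists_lift_iff_of_homotopic hs').1 ⟨s, rfl⟩
  exact ⟨hu.lift σ (𝟙 Y) (by rw [hσ, Category.id_comp]), hu.lift_snd _ _ _⟩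

lemma KanFibration.hasLiftingProperty_of_anodyne_section {X Y : SSet.{0}} {p : X ⟶ Y}
    (hp : KanFibration p) {s : Y ⟶ X} (hs : Anodyne s) (hsp : s ≫ p = 𝟙 Y) {M N : SSet.{0}}
    (m : M ⟶ N) [Mono m] : HasLiftingProperty m p where
  sq_hasLift {a b} sq := by
    have := hs.mono
    obtain ⟨D, hDp, -, hD₀, hD₁⟩ := exists_homotopy_of_anodyne s
      ((anodyne_iff_anodyneExtensions s).1 hs) hp (p ≫ s) (𝟙 X) (fst _ _ ≫ s) (fst _ _ ≫ p)
      (by rw [← Category.assoc s, hsp, Category.id_comp]; rfl)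
      (by rw [Category.comp_id]; rfl)
      (by rw [Category.assoc]; rfl)
      (by rw [Category.assoc, hsp, Category.comp_id]; rfl) rfl
    obtain ⟨L, hLp, hLm, -⟩ := exists_homotopy_extension 0 m hp (b ≫ s) (a ▷ Δ[1] ≫ D)
      (fst _ _ ≫ b)
      (by rw [← Category.assoc, ept_whiskerRight, Category.assoc, hD₀, ← Category.assoc, sq.w,
        Category.assoc])
      (by
        rw [Category.assoc, hDp]
        change fst _ _ ≫ a ≫ p = fst _ _ ≫ m ≫ b
        rw [sq.w])
      (by rw [Category.assoc, hsp, Category.comp_id]; rfl)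
    refine ⟨⟨⟨ept N 1 ≫ L, ?_, ?_⟩⟩⟩
    · rw [← Category.assoc, ← ept_whiskerRight, Category.assoc, hLm, ← Category.assoc,
        ept_whiskerRight, Category.assoc, hD₁, Category.comp_id]
    · rw [Category.assoc, hLp]
      rfl

lemma KanFibration.hasLiftingProperty_of_bijectiveOnClasses {X Y : SSet.{0}} {p : X ⟶ Y}
    (hp : KanFibration p) (hp' : BijectiveOnClasses p) {M N : SSet.{0}} (m : M ⟶ N) [Mono m] :
    HasLiftingProperty m p where
  sq_hasLift {a b} sq := by
    obtain ⟨s, hs⟩ := hp.exists_section hp'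
    obtain ⟨T, k, q, hk, hq, rfl⟩ := exists_factorization s
    rw [Category.assoc] at hs
    have hk' := hk.weakHomotopyEquivalence.bijectiveOnClasses
    have hqp : BijectiveOnClasses (q ≫ p) := hk'.of_comp_left (hs ▸ .id Y)
    obtain ⟨t, ht⟩ := hq.exists_section (hp'.of_comp_right hqp)
    have := (hq.comp hp).hasLiftingProperty_of_anodyne_section hk hs m
    have sq' : CommSq (a ≫ t) m (q ≫ p) b :=
      ⟨by rw [← sq.w, Category.assoc, ← Category.assoc t, ht, Category.id_comp]⟩
    refine ⟨⟨⟨sq'.lift ≫ q, ?_, ?_⟩⟩⟩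
    · rw [← Category.assoc, sq'.fac_left, Category.assoc, ht, Category.comp_id]
    · rw [Category.assoc, sq'.fac_right]

end Paper


/-- A map of simplicial sets is anodyne iff it is a monomorphism and
a weak homotopy equivalence. -/
theorem anodyne_iff {A B : SSet.{0}} (i : A ⟶ B) :
    Paper.Anodyne i ↔ (Mono i ∧ Paper.WeakHomotopyEquivalence i) := by
  refine ⟨fun hi => ⟨hi.mono, hi.weakHomotopyEquivalence⟩, fun ⟨_, hi⟩ X Y q hq => ?_⟩
  obtain ⟨Z, j, p, hj, hp, hjp⟩ := Paper.exists_factorization i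
  have hp' : Paper.BijectiveOnClasses p :=
    hj.weakHomotopyEquivalence.bijectiveOnClasses.of_comp_left
      (hjp ▸ hi.bijectiveOnClasses)
  have := hp.hasLiftingProperty_of_bijectiveOnClasses hp' i
  have := hj q hq
  refine ⟨fun {a b} sq => ?_⟩
  have sq₁ : CommSq j i p (𝟙 B) := ⟨by rw [hjp, Category.comp_id]⟩
  have sq₂ : CommSq a j q (p ≫ b) := ⟨by rw [sq.w, ← Category.assoc, hjp]⟩
  refine ⟨⟨⟨sq₁.lift ≫ sq₂.lift, ?_, ?_⟩⟩⟩
  · rw [← Category.assoc, sq₁.fac_left, sq₂.fac_left]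
  · rw [Category.assoc, sq₂.fac_right, ← Category.assoc, sq₁.fac_right, Category.id_comp]
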